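/- arXiv:math/0209087 — 3 statements merged into one kernel-verified Lean document; each statement's English description precedes it below -/
import Mathlib

section
/- For every real c ≥ 2.468155 and every sequence (m_n) of natural numbers with m_n/n → c as n → ∞, the probability that a uniformly random function G : Fin m_n → Fin n × Fin n admits a proper 3-colouring tends to 0 as n → ∞. -/
open Filter

/-- A proper 3-colouring of the multigraph `G : Fin m → Fin n × Fin n`. -/
def Proper {n m : ℕ} (G : Fin m → Fin n × Fin n) (σ : Fin n → Fin 3) : Prop :=
  ∀ e, σ (G e).1 ≠ σ (G e).2

/-- The Markov operator `Ψ ↦ (s ↦ 𝔼ᵢ Ψ (t i s))` for `i` uniform on a finite type. -/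
noncomputable def avgOp {ι S : Type*} [Fintype ι] (t : ι → S → S) : Module.End ℝ (S → ℝ) where
  toFun Ψ s := (Fintype.card ι : ℝ)⁻¹ * ∑ i, Ψ (t i s)
  map_add' Ψ Φ := by
    ext s
    simp [Finset.sum_add_distrib, mul_add]
  map_smul' c Ψ := by
    ext s
    simp [← Finset.mul_sum, mul_left_comm]

section avgOp

variable {ι S : Type*} [Fintype ι]

theorem avgOp_apply (t : ι → S → S) (Ψ : S → ℝ) (s : S) :
    avgOp t Ψ s = (Fintype.card ι : ℝ)⁻¹ * ∑ i, Ψ (t i s) := rfl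

theorem avgOp_const [Nonempty ι] (t : ι → S → S) (c : ℝ) :
    avgOp t (fun _ => c) = fun _ => c := by
  ext s
  simp [avgOp_apply]

theorem avgOp_pow_const [Nonempty ι] (t : ι → S → S) (c : ℝ) (N : ℕ) :
    (avgOp t ^ N) (fun _ => c) = fun _ => c := by
  induction N with
  | zero => simp
  | succ N ih => rw [pow_succ, Module.End.mul_apply, avgOp_const, ih]

theorem avgOp_pow_le_of_rel {S' : Type*} {t : ι → S → S} {t' : ι → S' → S'} (R : S → S' → Prop)
    (hR : ∀ i s s', R s s' → R (t i s) (t' i s')) {Ψ : S → ℝ} {Ψ' : S' → ℝ}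
    (h : ∀ s s', R s s' → Ψ s ≤ Ψ' s') (N : ℕ) {s : S} {s' : S'} (hs : R s s') :
    (avgOp t ^ N) Ψ s ≤ (avgOp t' ^ N) Ψ' s' := by
  induction N generalizing s s' with
  | zero => simpa using h s s' hs
  | succ N ih =>
    rw [pow_succ', pow_succ', Module.End.mul_apply, Module.End.mul_apply, avgOp_apply, avgOp_apply]
    gcongr with i
    exact ih (hR i s s' hs)

theorem avgOp_pow_mono (t : ι → S → S) {Ψ Φ : S → ℝ} (h : ∀ s, Ψ s ≤ Φ s) (N : ℕ) (s : S) :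
    (avgOp t ^ N) Ψ s ≤ (avgOp t ^ N) Φ s :=
  avgOp_pow_le_of_rel Eq (by rintro i s _ rfl; rfl) (by rintro s _ rfl; exact h s) N rfl

theorem avgOp_commute {κ : Type*} [Fintype κ] {t : ι → S → S} {t' : κ → S → S}
    (h : ∀ i j s, t i (t' j s) = t' j (t i s)) : Commute (avgOp t) (avgOp t') := by
  ext Ψ s
  simp only [Module.End.mul_apply, avgOp_apply, Finset.mul_sum, h]
  rw [Finset.sum_comm]
  exact Finset.sum_congr rfl fun _ _ => Finset.sum_congr rfl fun _ _ => by ring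

/-- If one step of `t` is dominated by one step of `t'` up to a constant, and the two commute, then
`N` steps of `t` are dominated by `N` steps of `t'`. -/
theorem avgOp_pow_le_avgOp_pow_sub {κ : Type*} [Fintype κ] [Nonempty ι] [Nonempty κ] {t : ι → S → S}
    {t' : κ → S → S} (hc : ∀ i j s, t i (t' j s) = t' j (t i s)) {Λ : S → ℝ} {K : ℝ}
    (h : ∀ s, avgOp t Λ s ≤ avgOp t' Λ s - K) (N : ℕ) (s : S) :
    (avgOp t ^ N) Λ s ≤ (avgOp t' ^ N) Λ s - N * K := by
  induction N generalizing s with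
  | zero => simp
  | succ N ih =>
    have h1 : (avgOp t ^ (N + 1)) Λ s ≤ (avgOp t ^ N) (avgOp t' Λ) s - K := by
      rw [pow_succ, Module.End.mul_apply]
      refine (avgOp_pow_mono t (Φ := avgOp t' Λ - fun _ => K) h N s).trans_eq ?_
      rw [map_sub, avgOp_pow_const]
      rfl
    have h2 : (avgOp t ^ N) (avgOp t' Λ) s = avgOp t' ((avgOp t ^ N) Λ) s := by
      rw [← Module.End.mul_apply, ((avgOp_commute hc).pow_left N).eq, Module.End.mul_apply]
    rw [h2] at h1
    have h3 : avgOp t' ((avgOp t ^ N) Λ) s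
        ≤ avgOp t' ((avgOp t' ^ N) Λ - fun _ => (N * K : ℝ)) s := by
      have := avgOp_pow_mono t' (Ψ := (avgOp t ^ N) Λ)
        (Φ := (avgOp t' ^ N) Λ - fun _ => (N * K : ℝ)) ih 1 s
      rwa [pow_one] at this
    rw [map_sub, avgOp_const, Pi.sub_apply] at h3
    rw [pow_succ' (avgOp t'), Module.End.mul_apply]
    push_cast
    linarith

theorem avgOp_pow_add_const [Nonempty ι] (t : ι → S → S) (Ψ : S → ℝ) (c : ℝ) (N : ℕ) (s : S) :
    (avgOp t ^ N) (fun s => Ψ s + c) s = (avgOp t ^ N) Ψ s + c := by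
  have : (fun s => Ψ s + c) = Ψ + fun _ => c := rfl
  rw [this, map_add, avgOp_pow_const]
  rfl

/-- Efron–Stein type bound: if each step changes `H` by an amount in `[0, 1]`, then the variance
of `H` after `N` steps is at most `N`. -/
theorem avgOp_pow_sq_sub_sq_le [Nonempty ι] {t : ι → S → S}
    (hc : ∀ i j s, t i (t j s) = t j (t i s)) {H : S → ℝ}
    (h0 : ∀ i s, H s ≤ H (t i s)) (h1 : ∀ i s, H (t i s) ≤ H s + 1) (N : ℕ) (s : S) :
    (avgOp t ^ N) (fun s => H s ^ 2) s ≤ (avgOp t ^ N) H s ^ 2 + N := by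
  induction N generalizing s with
  | zero => simp
  | succ N ih =>
    set g : ι → ℝ := fun i => (avgOp t ^ N) H (t i s)
    set b := (avgOp t ^ N) H s
    have hg0 : ∀ i, b ≤ g i := fun i =>
      avgOp_pow_le_of_rel (fun s s' => s' = t i s) (by rintro j s _ rfl; exact (hc i j s).symm)
        (by rintro s _ rfl; exact h0 i s) N rfl
    have hg1 : ∀ i, g i ≤ b + 1 := fun i => by
      rw [← avgOp_pow_add_const]
      exact avgOp_pow_le_of_rel (fun s' s => s' = t i s)
        (by rintro j _ s rfl; exact (hc i j s).symm) (by rintro _ s rfl; exact h1 i s) N rfl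
    have hn : (0 : ℝ) < Fintype.card ι := by exact_mod_cast Fintype.card_pos
    have e1 : (avgOp t ^ (N + 1)) (fun s => H s ^ 2) s
        ≤ (Fintype.card ι : ℝ)⁻¹ * ∑ i, (g i ^ 2 + N) := by
      rw [pow_succ', Module.End.mul_apply, avgOp_apply]
      gcongr with i
      exact ih (t i s)
    have e2 : (avgOp t ^ (N + 1)) H s = (Fintype.card ι : ℝ)⁻¹ * ∑ i, g i := by
      rw [pow_succ', Module.End.mul_apply, avgOp_apply]
    rw [e2]
    refine e1.trans ?_
    have e3 : ∑ i, (g i ^ 2 + N) ≤ ∑ i, ((2 * b + 1) * (g i - b) + b ^ 2 + N) := by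
      gcongr with i
      nlinarith [hg0 i, hg1 i]
    have e4 : ∑ i, b ≤ ∑ i, g i := Finset.sum_le_sum fun i _ => hg0 i
    have e5 : ∑ i, g i ≤ ∑ i, (b + 1) := Finset.sum_le_sum fun i _ => hg1 i
    simp only [Finset.sum_add_distrib, Finset.sum_const, Finset.card_univ, nsmul_eq_mul,
      ← Finset.mul_sum, Finset.sum_sub_distrib] at e3 e4 e5 ⊢
    set n : ℝ := (Fintype.card ι : ℝ)
    generalize ∑ i, g i = G at e3 e4 e5 ⊢
    obtain ⟨a, rfl⟩ : ∃ a, G = n * a := ⟨n⁻¹ * G, by field_simp⟩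
    have e6 : n⁻¹ * (n * a) = a := by field_simp
    rw [e6]
    rw [inv_mul_le_iff₀ hn]
    have e7 : b ≤ a := le_of_mul_le_mul_left e4 hn
    have e8 : a ≤ b + 1 := le_of_mul_le_mul_left (by linarith) hn
    push_cast
    have e9 : (2 * b + 1) * (a - b) + b ^ 2 ≤ a ^ 2 + 1 := by nlinarith
    nlinarith

/-- The lazy version of a family of steps: stay put with probability `1 / 2`. -/
def lazyStep (t : ι → S → S) : Bool × ι → S → S
  | (true, i), s => t i s
  | (false, _), s => s

theorem avgOp_lazyStep [Nonempty ι] (t : ι → S → S) :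
    avgOp (lazyStep t) = (1 / 2 : ℝ) • (1 + avgOp t) := by
  ext Ψ s
  simp only [avgOp_apply, Fintype.sum_prod_type, Fintype.sum_bool, lazyStep, LinearMap.smul_apply,
    LinearMap.add_apply, Pi.smul_apply, Pi.add_apply, Module.End.one_apply, Fintype.card_prod,
    Fintype.card_bool, Finset.sum_const, Finset.card_univ, smul_eq_mul, nsmul_eq_mul]
  push_cast
  field_simp
  ring

theorem avgOp_pow_antitone {t : ι → S → S} {Ψ : S → ℝ} (h : ∀ s, avgOp t Ψ s ≤ Ψ s) (s : S) :
    Antitone fun k => (avgOp t ^ k) Ψ s :=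
  antitone_nat_of_succ_le fun k => by
    rw [pow_succ, Module.End.mul_apply]
    exact avgOp_pow_mono t h k s

/-- For a decreasing functional, `2 m + 1` lazy steps are at least half as good as `m` steps. -/
theorem avgOp_pow_le_two_mul_lazyStep [Nonempty ι] {t : ι → S → S} {Ψ : S → ℝ}
    (h0 : ∀ s, 0 ≤ Ψ s) (h : ∀ s, avgOp t Ψ s ≤ Ψ s) (m : ℕ) (s : S) :
    (avgOp t ^ m) Ψ s ≤ 2 * (avgOp (lazyStep t) ^ (2 * m + 1)) Ψ s := by
  have hnn : ∀ k, 0 ≤ (avgOp t ^ k) Ψ s := fun k => by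
    simpa [avgOp_pow_const] using avgOp_pow_mono t (Ψ := fun _ => 0) h0 k s
  have e : (avgOp (lazyStep t) ^ (2 * m + 1)) Ψ s = (1 / 2) ^ (2 * m + 1) *
      ∑ k ∈ Finset.range (2 * m + 2), (avgOp t ^ k) Ψ s * (2 * m + 1).choose k := by
    rw [avgOp_lazyStep, smul_pow, add_comm 1, (Commute.one_right _).add_pow]
    simp only [one_pow, mul_one, LinearMap.smul_apply, LinearMap.sum_apply, Pi.smul_apply,
      Finset.sum_apply, smul_eq_mul]
    congr 1
    refine Finset.sum_congr rfl fun k _ => ?_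
    rw [← nsmul_one, mul_smul_comm, mul_one, LinearMap.smul_apply, Pi.smul_apply, nsmul_eq_mul,
      mul_comm]
  have e2 : (avgOp t ^ m) Ψ s * 4 ^ m ≤
      ∑ k ∈ Finset.range (2 * m + 2), (avgOp t ^ k) Ψ s * (2 * m + 1).choose k := by
    have h4 : (4 : ℝ) ^ m = ∑ k ∈ Finset.range (m + 1), ((2 * m + 1).choose k : ℝ) := by
      exact_mod_cast (Nat.sum_range_choose_halfway m).symm
    rw [h4, Finset.mul_sum]
    refine (Finset.sum_le_sum fun k hk => ?_).trans
      (Finset.sum_le_sum_of_subset_of_nonneg (Finset.range_mono (by omega))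
        fun k _ _ => mul_nonneg (hnn k) (Nat.cast_nonneg _))
    gcongr
    exact avgOp_pow_antitone h s (by simpa [Nat.lt_succ_iff] using hk)
  rw [e, pow_succ, pow_mul]
  have e3 : ((1 / 2 : ℝ) ^ 2) ^ m * 4 ^ m = 1 := by
    rw [← mul_pow]; norm_num
  have e4 : (0 : ℝ) ≤ ((1 / 2 : ℝ) ^ 2) ^ m := by positivity
  calc (avgOp t ^ m) Ψ s = ((1 / 2 : ℝ) ^ 2) ^ m * ((avgOp t ^ m) Ψ s * 4 ^ m) := by
        rw [mul_left_comm, e3, mul_one]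
    _ ≤ _ := mul_le_mul_of_nonneg_left e2 e4
    _ = _ := by ring

end avgOp

section Kernel

variable {P X α : Type*} [Fintype X] [Fintype α]

theorem sum_mul_kernel_pow_nonneg (L : (P → ℝ) →ₗ[ℝ] ℝ) (hL : ∀ φ, (∀ p, 0 ≤ φ p) → 0 ≤ L φ)
    {ψ : P → ℝ} (hψ : ∀ p, 0 ≤ ψ p) (G : α → X → P → ℝ) (m : ℕ) (c : X → ℝ) :
    0 ≤ ∑ x, ∑ y, c x * c y * (∑ a, L fun p => ψ p * G a x p * G a y p) ^ m := by
  classical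
  set K : X → X → ℝ := fun x y => ∑ a, L fun p => ψ p * G a x p * G a y p with hK
  suffices ∀ c : X → ℝ, 0 ≤ ∑ x, ∑ y, c x * c y * K x y ^ m from this c
  induction m with
  | zero =>
    intro c
    simp only [pow_zero, mul_one, ← Finset.mul_sum, ← Finset.sum_mul]
    exact mul_self_nonneg _
  | succ m ih =>
    intro c
    have key : ∑ x, ∑ y, c x * c y * K x y ^ (m + 1) = ∑ a, L fun p => ψ p *
        ∑ x, ∑ y, (c x * G a x p) * (c y * G a y p) * K x y ^ m := by
      have h : ∀ a, (fun p => ψ p * ∑ x, ∑ y, (c x * G a x p) * (c y * G a y p) * K x y ^ m)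
          = ∑ x, ∑ y, (c x * c y * K x y ^ m) • fun p => ψ p * G a x p * G a y p := by
        intro a
        ext p
        simp only [Finset.mul_sum, Finset.sum_apply, Pi.smul_apply, smul_eq_mul]
        exact Finset.sum_congr rfl fun _ _ => Finset.sum_congr rfl fun _ _ => by ring
      simp only [h, map_sum, map_smul, smul_eq_mul]
      refine (Finset.sum_comm.trans (Finset.sum_congr rfl fun x _ => Finset.sum_comm.trans
        (Finset.sum_congr rfl fun y _ => ?_))).symm
      rw [← Finset.mul_sum, pow_succ, mul_assoc]
    rw [key]
    exact Finset.sum_nonneg fun a _ => hL _ fun p => mul_nonneg (hψ p) (ih _)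

theorem sum_mul_neg_log_one_sub_nonneg {K : X → X → ℝ} (hK : ∀ x y, |K x y| < 1) (c : X → ℝ)
    (h : ∀ m : ℕ, 0 ≤ ∑ x, ∑ y, c x * c y * K x y ^ m) :
    0 ≤ ∑ x, ∑ y, c x * c y * -Real.log (1 - K x y) := by
  have hs : HasSum (fun m : ℕ => ∑ x, ∑ y, c x * c y * (K x y ^ (m + 1) / (m + 1)))
      (∑ x, ∑ y, c x * c y * -Real.log (1 - K x y)) :=
    hasSum_sum fun x _ => hasSum_sum fun y _ =>
      (Real.hasSum_pow_div_log_of_abs_lt_one (hK x y)).mul_left _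
  refine hs.nonneg fun m => ?_
  have : ∑ x, ∑ y, c x * c y * (K x y ^ (m + 1) / (m + 1))
      = (∑ x, ∑ y, c x * c y * K x y ^ (m + 1)) / (m + 1) := by
    simp only [Finset.sum_div, mul_div_assoc]
  rw [this]
  exact div_nonneg (h _) (by positivity)

end Kernel

section Config

variable {V : Type*} [Fintype V]

/-- A cost function on the 3-colourings of `V`, split into a general part and a part that is a sum
of costs of the individual vertices. -/
abbrev Config (V : Type*) := ((V → Fin 3) → ℕ) × (V → Fin 3 → ℕ)

/-- The total cost of a colouring. -/
def energy (p : Config V) (σ : V → Fin 3) : ℕ := p.1 σ + ∑ v, p.2 v (σ v)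

/-- The smallest cost of a colouring. -/
noncomputable def minEnergy (p : Config V) : ℕ := ⨅ σ, energy p σ

theorem energy_add (p r : Config V) (σ : V → Fin 3) :
    energy (p + r) σ = energy p σ + energy r σ := by
  simp [energy, Finset.sum_add_distrib]
  ring

theorem minEnergy_le (p : Config V) (σ : V → Fin 3) : minEnergy p ≤ energy p σ :=
  ciInf_le' _ σ

theorem exists_energy_eq_minEnergy (p : Config V) : ∃ σ, energy p σ = minEnergy p :=
  exists_eq_ciInf_of_finite

theorem minEnergy_le_minEnergy_add (p r : Config V) : minEnergy p ≤ minEnergy (p + r) := by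
  obtain ⟨σ, hσ⟩ := exists_energy_eq_minEnergy (p + r)
  rw [← hσ, energy_add]
  exact (minEnergy_le p σ).trans (Nat.le_add_right _ _)

theorem minEnergy_add_le (p : Config V) {r : Config V} (hr : ∀ σ, energy r σ ≤ 1) :
    minEnergy (p + r) ≤ minEnergy p + 1 := by
  obtain ⟨σ, hσ⟩ := exists_energy_eq_minEnergy p
  refine (minEnergy_le _ σ).trans ?_
  rw [energy_add, hσ]
  exact Nat.add_le_add_left (hr σ) _

/-- The cost of an edge: `1` if it is monochromatic. -/
def edgeCost (i j : V) : Config V := (fun σ => if σ i = σ j then 1 else 0, 0)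

theorem energy_edgeCost (i j : V) (σ : V → Fin 3) :
    energy (edgeCost i j) σ = if σ i = σ j then 1 else 0 := by
  simp [energy, edgeCost]

/-- The vertex `i` has colour `a` in all the colourings of smallest cost. -/
def Frozen (p : Config V) (i : V) (a : Fin 3) : Prop := ∀ σ, energy p σ = minEnergy p → σ i = a

theorem Frozen.eq {p : Config V} {i : V} {a b : Fin 3} (ha : Frozen p i a) (hb : Frozen p i b) :
    a = b := by
  obtain ⟨σ, hσ⟩ := exists_energy_eq_minEnergy p
  rw [← ha σ hσ, hb σ hσ]

theorem minEnergy_add_edgeCost {p : Config V} {i j : V} {a : Fin 3} (hi : Frozen p i a)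
    (hj : Frozen p j a) : minEnergy p + 1 ≤ minEnergy (p + edgeCost i j) := by
  obtain ⟨σ, hσ⟩ := exists_energy_eq_minEnergy (p + edgeCost i j)
  rw [← hσ, energy_add, energy_edgeCost]
  split_ifs with h
  · exact Nat.add_le_add_right (minEnergy_le p σ) 1
  · refine Nat.lt_of_le_of_ne (minEnergy_le p σ) fun he => h ?_
    rw [hi σ he.symm, hj σ he.symm]

theorem energy_edgeCost_le (i j : V) (σ : V → Fin 3) : energy (edgeCost i j) σ ≤ 1 := by
  rw [energy_edgeCost]; split_ifs <;> simp

open Classical in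
/-- The indicator function of `Frozen`. -/
noncomputable def frozenInd (a : Fin 3) (i : V) (p : Config V) : ℝ := if Frozen p i a then 1 else 0

theorem frozenInd_nonneg (a : Fin 3) (i : V) (p : Config V) : 0 ≤ frozenInd a i p := by
  unfold frozenInd; split_ifs <;> simp

theorem frozenInd_le_one (a : Fin 3) (i : V) (p : Config V) : frozenInd a i p ≤ 1 := by
  unfold frozenInd; split_ifs <;> simp

theorem sum_frozenInd_le_one (i : V) (p : Config V) : ∑ a, frozenInd a i p ≤ 1 := by
  by_cases h : ∃ a, Frozen p i a
  · obtain ⟨a, ha⟩ := h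
    rw [Finset.sum_eq_single a]
    · exact frozenInd_le_one a i p
    · intro b _ hb
      rw [frozenInd, if_neg fun h => hb (h.eq ha)]
    · simp
  · push Not at h
    simp [frozenInd, h]

theorem sum_frozenInd_mul_le_one (i j : V) (p : Config V) :
    ∑ a, frozenInd a i p * frozenInd a j p ≤ 1 :=
  (Finset.sum_le_sum fun a _ =>
    mul_le_of_le_one_right (frozenInd_nonneg a i p) (frozenInd_le_one a j p)).trans
    (sum_frozenInd_le_one i p)

theorem pow_minEnergy_add_edgeCost_le {θ : ℝ} (h0 : 0 ≤ θ) (h1 : θ ≤ 1) (p : Config V) (i j : V) :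
    θ ^ minEnergy (p + edgeCost i j) ≤
      θ ^ minEnergy p * (1 - (1 - θ) * ∑ a, frozenInd a i p * frozenInd a j p) := by
  have hp := pow_nonneg h0 (minEnergy p)
  by_cases h : ∃ a, Frozen p i a ∧ Frozen p j a
  · obtain ⟨a, hi, hj⟩ := h
    calc θ ^ minEnergy (p + edgeCost i j) ≤ θ ^ (minEnergy p + 1) :=
          pow_le_pow_of_le_one h0 h1 (minEnergy_add_edgeCost hi hj)
      _ = θ ^ minEnergy p * (1 - (1 - θ) * 1) := by rw [pow_succ]; ring
      _ ≤ _ := by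
        gcongr
        exact sum_frozenInd_mul_le_one i j p
  · push Not at h
    have : ∑ a, frozenInd a i p * frozenInd a j p = 0 := Finset.sum_eq_zero fun a _ => by
      by_cases hi : Frozen p i a
      · rw [frozenInd, frozenInd, if_neg (h a hi), mul_zero]
      · rw [frozenInd, if_neg hi, zero_mul]
    rw [this, mul_zero, sub_zero, mul_one]
    exact pow_le_pow_of_le_one h0 h1 (minEnergy_le_minEnergy_add _ _)

variable [DecidableEq V]

/-- The cost of a forbidden colour `a` at the vertex `i`. -/
def fieldCost (i : V) (a : Fin 3) : Config V := (0, Pi.single i (Pi.single a 1))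

theorem energy_fieldCost (i : V) (a : Fin 3) (σ : V → Fin 3) :
    energy (fieldCost i a) σ = if σ i = a then 1 else 0 := by
  have h : ∀ v ∈ Finset.univ, v ≠ i →
      (Pi.single i (Pi.single a 1) : V → Fin 3 → ℕ) v (σ v) = 0 := by
    intro v _ hv
    simp [Pi.single_eq_of_ne hv]
  simp only [energy, fieldCost, Pi.zero_apply, zero_add]
  rw [Finset.sum_eq_single i h (by simp)]
  simp [Pi.single_apply]

theorem minEnergy_add_fieldCost {p : Config V} {i : V} {a : Fin 3} (h : ¬ Frozen p i a) :
    minEnergy (p + fieldCost i a) ≤ minEnergy p := by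
  simp only [Frozen, not_forall] at h
  obtain ⟨σ, hσ, ha⟩ := h
  refine (minEnergy_le _ σ).trans ?_
  rw [energy_add, energy_fieldCost, if_neg ha, hσ, add_zero]

theorem energy_fieldCost_le (i : V) (a : Fin 3) (σ : V → Fin 3) :
    energy (fieldCost i a) σ ≤ 1 := by
  rw [energy_fieldCost]; split_ifs <;> simp

theorem le_pow_minEnergy_add_fieldCost {θ : ℝ} (h0 : 0 ≤ θ) (h1 : θ ≤ 1) (p : Config V) (i : V)
    (a : Fin 3) :
    θ ^ minEnergy p * (1 - (1 - θ) * frozenInd a i p) ≤ θ ^ minEnergy (p + fieldCost i a) := by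
  by_cases h : Frozen p i a
  · calc θ ^ minEnergy p * (1 - (1 - θ) * frozenInd a i p) = θ ^ (minEnergy p + 1) := by
          rw [frozenInd, if_pos h, pow_succ]; ring
      _ ≤ _ := pow_le_pow_of_le_one h0 h1 (minEnergy_add_le p (energy_fieldCost_le i a))
  · rw [frozenInd, if_neg h, mul_zero, sub_zero, mul_one]
    exact pow_le_pow_of_le_one h0 h1 (minEnergy_add_fieldCost h)

end Config

section State

variable {V : Type*}

/-- Translation of functions on configurations. -/
def shift (r : Config V) : Module.End ℝ (Config V → ℝ) := LinearMap.funLeft ℝ ℝ (· + r)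

theorem shift_apply (r : Config V) (φ : Config V → ℝ) (p : Config V) :
    shift r φ p = φ (p + r) := rfl

theorem shift_commute (r r' : Config V) : Commute (shift r) (shift r') := by
  ext φ p
  simp [shift_apply, add_right_comm]

/-- Adding a random field at the vertex `i`: each colour is forbidden with probability `1 / 4`, and
with probability `1 / 4` no colour is. -/
noncomputable def fieldOp [DecidableEq V] (i : V) : Module.End ℝ (Config V → ℝ) :=
  (1 / 4 : ℝ) • (1 + ∑ a, shift (fieldCost i a))

theorem fieldOp_apply [DecidableEq V] (i : V) (φ : Config V → ℝ) (p : Config V) :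
    fieldOp i φ p = 1 / 4 * (φ p + ∑ a, φ (p + fieldCost i a)) := by
  simp [fieldOp, shift_apply, mul_add]

variable [Fintype V]

/-- A random configuration, given by its expectation functional. -/
@[ext]
structure State (V : Type*) [Fintype V] where
  /-- The expectation. -/
  toFun : (Config V → ℝ) →ₗ[ℝ] ℝ
  nonneg' : ∀ φ, (∀ p, 0 ≤ φ p) → 0 ≤ toFun φ
  pos' : ∀ θ : ℝ, 0 < θ → θ ≤ 1 → 0 < toFun fun p => θ ^ minEnergy p

namespace State

theorem mono (s : State V) {φ ψ : Config V → ℝ} (h : ∀ p, φ p ≤ ψ p) :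
    s.toFun φ ≤ s.toFun ψ := by
  have := s.nonneg' (ψ - φ) fun p => sub_nonneg.2 (h p)
  rwa [map_sub, sub_nonneg] at this

/-- The deterministic configuration `p`. -/
def dirac (p : Config V) : State V where
  toFun := LinearMap.proj p
  nonneg' _ h := h p
  pos' _ h _ := pow_pos h _

/-- Apply an operator that is bounded below by `θ` on `θ ^ minEnergy`. -/
def mapOp (s : State V) (U : Module.End ℝ (Config V → ℝ))
    (hU : ∀ φ, (∀ p, 0 ≤ φ p) → ∀ p, 0 ≤ U φ p)
    (hU' : ∀ θ : ℝ, 0 < θ → θ ≤ 1 → ∀ p,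
      θ * θ ^ minEnergy p ≤ U (fun p => θ ^ minEnergy p) p) : State V where
  toFun := s.toFun ∘ₗ U
  nonneg' φ h := s.nonneg' _ (hU φ h)
  pos' θ h h1 := by
    have h2 : s.toFun (θ • fun p => θ ^ minEnergy p)
        ≤ s.toFun (U fun p => θ ^ minEnergy p) := s.mono (hU' θ h h1)
    rw [map_smul, smul_eq_mul] at h2
    exact (mul_pos h (s.pos' θ h h1)).trans_le h2

theorem mul_pow_le_shift {r : Config V} (hr : ∀ σ, energy r σ ≤ 1) {θ : ℝ} (h0 : 0 < θ)
    (h1 : θ ≤ 1) (p : Config V) :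
    θ * θ ^ minEnergy p ≤ shift r (fun p => θ ^ minEnergy p) p := by
  rw [shift_apply, ← pow_succ']
  exact pow_le_pow_of_le_one h0.le h1 (minEnergy_add_le p hr)

/-- Add an edge. -/
def addEdge (e : V × V) (s : State V) : State V :=
  s.mapOp (shift (edgeCost e.1 e.2)) (fun _ h _ => h _)
    fun _ h0 h1 => mul_pow_le_shift (energy_edgeCost_le _ _) h0 h1

/-- `frozenInd`, with an additional point at which it is constant. -/
noncomputable def frozenExt (a : Fin 3) : Option V → Config V → ℝ
  | none => fun _ => 1 / 4
  | some i => frozenInd a i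

theorem frozenExt_nonneg (a : Fin 3) (x : Option V) (p : Config V) : 0 ≤ frozenExt a x p := by
  cases x
  · simp [frozenExt]
  · exact frozenInd_nonneg _ _ _

theorem sum_frozenExt_mul_le_one (x y : Option V) (p : Config V) :
    ∑ a, frozenExt a x p * frozenExt a y p ≤ 1 := by
  have h : ∀ y : Option V, ∀ a, frozenExt a y p ≤ 1 := by
    intro y a
    cases y
    · norm_num [frozenExt]
    · exact frozenInd_le_one _ _ _
  refine (Finset.sum_le_sum fun a _ =>
    mul_le_of_le_one_right (frozenExt_nonneg a x p) (h y a)).trans ?_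
  cases x
  · norm_num [frozenExt]
  · exact sum_frozenInd_le_one _ _

variable [DecidableEq V]

/-- Add a random field. -/
noncomputable def addField (i : V) (s : State V) : State V :=
  s.mapOp (fieldOp i)
    (fun φ h p => by
      rw [fieldOp_apply]
      have := Finset.sum_nonneg fun (a : Fin 3) (_ : a ∈ Finset.univ) => h (p + fieldCost i a)
      have := h p
      positivity)
    fun θ h0 h1 p => by
      have h := Finset.sum_le_sum fun (a : Fin 3) (_ : a ∈ Finset.univ) =>
        mul_pow_le_shift (energy_fieldCost_le i a) h0 h1 p
      simp only [shift_apply, Finset.sum_const, Finset.card_univ, Fintype.card_fin,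
        nsmul_eq_mul] at h
      have h2 : θ * θ ^ minEnergy p ≤ θ ^ minEnergy p := mul_le_of_le_one_left (by positivity) h1
      rw [fieldOp_apply]
      push_cast at h
      linarith

theorem addEdge_addField (e : V × V) (i : V) (s : State V) :
    addEdge e (addField i s) = addField i (addEdge e s) := by
  have : Commute (fieldOp i) (shift (edgeCost e.1 e.2)) :=
    (((Commute.one_left _).add_left
      (Commute.sum_left _ _ _ fun a _ => shift_commute _ _))).smul_left _
  ext1
  change (s.toFun ∘ₗ fieldOp i) ∘ₗ shift _ = (s.toFun ∘ₗ shift _) ∘ₗ fieldOp i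
  rw [LinearMap.comp_assoc, LinearMap.comp_assoc]
  exact congrArg _ this

/-- The logarithm of the expectation of `θ ^ minEnergy`. -/
noncomputable def logPartition (θ : ℝ) (s : State V) : ℝ :=
  Real.log (s.toFun fun p => θ ^ minEnergy p)

/-- The interpolation inequality: on average, an edge costs at least as much as two random fields,
up to a constant. -/
theorem logPartition_interpolation [Nonempty V] {θ : ℝ} (h0 : 0 < θ) (h1 : θ < 1) (s : State V) :
    avgOp (lazyStep addEdge) (logPartition θ) s ≤
      avgOp addField (logPartition θ) s - 1 / 2 * Real.log (1 - (1 - θ) * (3 / 16)) := by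
  set ψ : Config V → ℝ := fun p => θ ^ minEnergy p
  have hψ : ∀ p, 0 ≤ ψ p := fun p => by positivity
  set w := s.toFun ψ
  have hw : 0 < w := s.pos' θ h0 h1.le
  have h1' : 0 < 1 - θ := sub_pos.2 h1
  set M : Option V → Option V → ℝ :=
    fun x y => ∑ a, s.toFun fun p => ψ p * frozenExt a x p * frozenExt a y p with hM
  have hM' : ∀ x y, M x y = s.toFun fun p => ψ p * ∑ a, frozenExt a x p * frozenExt a y p := by
    intro x y
    rw [hM]
    simp only
    rw [← map_sum]
    congr 1
    ext p
    simp [Finset.mul_sum, mul_assoc]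
  have hM0 : ∀ x y, 0 ≤ M x y := fun x y => by
    rw [hM']
    exact s.nonneg' _ fun p => mul_nonneg (hψ p) (Finset.sum_nonneg fun a _ =>
      mul_nonneg (frozenExt_nonneg _ _ _) (frozenExt_nonneg _ _ _))
  have hM1 : ∀ x y, M x y ≤ w := fun x y => by
    rw [hM']
    exact s.mono fun p => mul_le_of_le_one_right (hψ p) (sum_frozenExt_mul_le_one x y p)
  set k : Option V → Option V → ℝ := fun x y => (1 - θ) / w * M x y
  have hk0 : ∀ x y, 0 ≤ k x y := fun x y => by
    have := hM0 x y
    positivity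
  have hk1 : ∀ x y, k x y < 1 := fun x y => by
    have : k x y ≤ (1 - θ) / w * w := mul_le_mul_of_nonneg_left (hM1 x y) (by positivity)
    rw [div_mul_cancel₀ _ hw.ne'] at this
    linarith
  have hpsd : ∀ (c : Option V → ℝ) (m : ℕ), 0 ≤ ∑ x, ∑ y, c x * c y * k x y ^ m := by
    intro c m
    have h : ∑ x, ∑ y, c x * c y * k x y ^ m
        = ((1 - θ) / w) ^ m * ∑ x, ∑ y, c x * c y * M x y ^ m := by
      simp only [Finset.mul_sum, k, mul_pow]
      exact Finset.sum_congr rfl fun _ _ => Finset.sum_congr rfl fun _ _ => by ring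
    rw [h]
    exact mul_nonneg (by positivity)
      (sum_mul_kernel_pow_nonneg s.toFun s.nonneg' hψ (fun a x => frozenExt a x) m c)
  have hedge : ∀ i j, logPartition θ (addEdge (i, j) s) ≤
      Real.log w + Real.log (1 - k (some i) (some j)) := by
    intro i j
    rw [← Real.log_mul hw.ne' (sub_pos.2 (hk1 _ _)).ne']
    refine Real.log_le_log ((addEdge (i, j) s).pos' θ h0 h1.le) ?_
    have e : w * (1 - k (some i) (some j))
        = s.toFun (ψ - (1 - θ) • fun p => ψ p * ∑ a, frozenInd a i p * frozenInd a j p) := by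
      rw [map_sub, map_smul, smul_eq_mul]
      change _ = w - (1 - θ) * s.toFun fun p => ψ p * ∑ a, frozenExt a (some i) p *
        frozenExt a (some j) p
      rw [← hM']
      simp only [k]
      field_simp
    rw [e]
    refine s.mono fun p => (pow_minEnergy_add_edgeCost_le h0.le h1.le p i j).trans_eq ?_
    simp only [Pi.sub_apply, Pi.smul_apply, smul_eq_mul, ψ]
    ring
  have hfield : ∀ i, Real.log w + Real.log (1 - k (some i) none) ≤
      logPartition θ (addField i s) := by
    intro i
    rw [← Real.log_mul hw.ne' (sub_pos.2 (hk1 _ _)).ne']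
    refine Real.log_le_log (mul_pos hw (sub_pos.2 (hk1 _ _))) ?_
    have e : w * (1 - k (some i) none)
        = s.toFun (ψ - (1 - θ) • fun p => ψ p * ∑ a, frozenInd a i p * (1 / 4)) := by
      rw [map_sub, map_smul, smul_eq_mul]
      change _ = w - (1 - θ) * s.toFun fun p => ψ p * ∑ a, frozenExt a (some i) p *
        frozenExt a none p
      rw [← hM']
      simp only [k]
      field_simp
    rw [e]
    refine s.mono fun p => ?_
    rw [fieldOp_apply]
    have h := Finset.sum_le_sum fun (a : Fin 3) (_ : a ∈ Finset.univ) =>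
      le_pow_minEnergy_add_fieldCost h0.le h1.le p i a
    refine le_trans (le_of_eq ?_) (mul_le_mul_of_nonneg_left (add_le_add_right h _) (by norm_num))
    simp only [Pi.sub_apply, Pi.smul_apply, smul_eq_mul, ψ, Fin.sum_univ_three]
    ring
  have hnone : k none none = (1 - θ) * (3 / 16) := by
    have : M none none = 3 / 16 * w := by
      rw [hM']
      have : (fun p => ψ p * ∑ a : Fin 3, frozenExt a (none : Option V) p * frozenExt a none p)
          = (3 / 16 : ℝ) • ψ := by
        ext p
        norm_num [frozenExt, Fin.sum_univ_three]
        ring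
      rw [this, map_smul, smul_eq_mul]
    simp only [k, this]
    field_simp
  have hsymm : ∀ i, k none (some i) = k (some i) none := fun i => by
    simp only [k, hM']
    simp only [mul_comm]
  set n : ℝ := (Fintype.card V : ℝ)
  have hn : 0 < n := Nat.cast_pos.2 Fintype.card_pos
  have main := sum_mul_neg_log_one_sub_nonneg
    (fun x y => (abs_of_nonneg (hk0 x y)).trans_lt (hk1 x y))
    (fun x : Option V => x.elim (-1) fun _ => n⁻¹) (hpsd _)
  simp only [Fintype.sum_option, Option.elim, hsymm, hnone] at main
  rw [avgOp_lazyStep]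
  simp only [LinearMap.smul_apply, LinearMap.add_apply, Pi.smul_apply, Pi.add_apply,
    Module.End.one_apply, avgOp_apply, smul_eq_mul, Fintype.sum_prod_type, Fintype.card_prod]
  have hE : ∑ i, ∑ j, logPartition θ (addEdge (i, j) s) ≤
      ∑ i, ∑ j, (Real.log w + Real.log (1 - k (some i) (some j))) :=
    Finset.sum_le_sum fun i _ => Finset.sum_le_sum fun j _ => hedge i j
  have hF : ∑ i, (Real.log w + Real.log (1 - k (some i) none)) ≤
      ∑ i, logPartition θ (addField i s) := Finset.sum_le_sum fun i _ => hfield i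
  simp only [Finset.sum_add_distrib, Finset.sum_const, Finset.card_univ, nsmul_eq_mul,
    mul_neg, Finset.sum_neg_distrib, ← Finset.mul_sum, mul_one, one_mul, neg_mul, neg_neg]
    at hE hF main
  have hL : logPartition θ s = Real.log w := rfl
  rw [hL]
  push_cast
  change _ ≤ n * (n * _) + _ at hE
  change n * _ + _ ≤ _ at hF
  generalize ∑ i, ∑ j, Real.log (1 - k (some i) (some j)) = X at *
  generalize ∑ i, Real.log (1 - k (some i) none) = Y at *
  generalize ∑ i, ∑ j, logPartition θ (addEdge (i, j) s) = E at *
  generalize ∑ i, logPartition θ (addField i s) = F at *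
  have hE' : (n * n)⁻¹ * E ≤ Real.log w + n⁻¹ * n⁻¹ * X := by
    calc (n * n)⁻¹ * E ≤ (n * n)⁻¹ * (n * (n * Real.log w) + X) := by gcongr
      _ = _ := by field_simp
  have hF' : Real.log w + n⁻¹ * Y ≤ n⁻¹ * F := by
    calc _ = n⁻¹ * (n * Real.log w + Y) := by field_simp
      _ ≤ _ := by gcongr
  linarith

end State

end State

section Weight

/-- The coefficients of the expansion of `if ∃ a, f a = 1 then 1 else θ` into products of the
indicators `f`. -/
noncomputable def freeCoeff (θ : ℝ) (T : Finset (Fin 3)) : ℝ :=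
  (if T = ∅ then 1 else 0) - (1 - θ) * (-1) ^ T.card

/-- The expected weight of a vertex after `d` random fields. -/
noncomputable def fieldWeight (θ : ℝ) (d : ℕ) : ℝ :=
  ∑ T, freeCoeff θ T * (1 - T.card / 4) ^ d

theorem sum_finset_fin_three (f : Finset (Fin 3) → ℝ) :
    ∑ T, f T = f ∅ + f {0} + f {1} + f {2} + f {0, 1} + f {0, 2} + f {1, 2} + f {0, 1, 2} := by
  have : (Finset.univ : Finset (Finset (Fin 3))) =
    {∅, {0}, {1}, {2}, {0, 1}, {0, 2}, {1, 2}, {0, 1, 2}} := by decide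
  rw [this, Finset.sum_insert (by decide), Finset.sum_insert (by decide),
    Finset.sum_insert (by decide), Finset.sum_insert (by decide), Finset.sum_insert (by decide),
    Finset.sum_insert (by decide), Finset.sum_insert (by decide), Finset.sum_singleton]
  ring

theorem sum_freeCoeff_mul (θ : ℝ) (f : Finset (Fin 3) → ℝ) :
    ∑ T, freeCoeff θ T * f T = θ * f ∅ + (1 - θ) * (f {0} + f {1} + f {2} -
      f {0, 1} - f {0, 2} - f {1, 2} + f {0, 1, 2}) := by
  have h : ∀ T : Finset (Fin 3), T.Nonempty → freeCoeff θ T = -(1 - θ) * (-1) ^ T.card :=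
    fun T hT => by rw [freeCoeff, if_neg hT.ne_empty]; ring
  have h0 : freeCoeff θ ∅ = θ := by simp [freeCoeff]
  rw [sum_finset_fin_three, h0, h {0} (by decide), h {1} (by decide), h {2} (by decide),
    h {0, 1} (by decide), h {0, 2} (by decide), h {1, 2} (by decide), h {0, 1, 2} (by decide),
    Finset.card_singleton, Finset.card_singleton, Finset.card_singleton,
    show ({0, 1} : Finset (Fin 3)).card = 2 by decide,
    show ({0, 2} : Finset (Fin 3)).card = 2 by decide,
    show ({1, 2} : Finset (Fin 3)).card = 2 by decide,
    show ({0, 1, 2} : Finset (Fin 3)).card = 3 by decide]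
  ring

theorem fieldWeight_eq (θ : ℝ) (d : ℕ) :
    fieldWeight θ d = θ + (1 - θ) * (3 * (3 / 4) ^ d - 3 * (1 / 2) ^ d + (1 / 4) ^ d) := by
  rw [fieldWeight, sum_freeCoeff_mul, Finset.card_singleton, Finset.card_singleton,
    Finset.card_singleton, Finset.card_empty,
    show ({0, 1} : Finset (Fin 3)).card = 2 by decide,
    show ({0, 2} : Finset (Fin 3)).card = 2 by decide,
    show ({1, 2} : Finset (Fin 3)).card = 2 by decide,
    show ({0, 1, 2} : Finset (Fin 3)).card = 3 by decide]
  push_cast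
  rw [show (1 - 1 / 4 : ℝ) = 3 / 4 by norm_num, show (1 - 2 / 4 : ℝ) = 1 / 2 by norm_num,
    show (1 - 3 / 4 : ℝ) = 1 / 4 by norm_num, zero_div, sub_zero, one_pow]
  ring

theorem fieldWeight_pos {θ : ℝ} (h0 : 0 < θ) (h1 : θ ≤ 1) (d : ℕ) : 0 < fieldWeight θ d := by
  rw [fieldWeight_eq]
  have h : (1 / 2 : ℝ) ^ d ≤ (3 / 4) ^ d :=
    pow_le_pow_left₀ (by norm_num) (by norm_num) d
  have h' : (0 : ℝ) < (1 / 4) ^ d := by positivity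
  nlinarith

theorem fieldWeight_le_one {θ : ℝ} (h1 : θ ≤ 1) (d : ℕ) : fieldWeight θ d ≤ 1 := by
  rw [fieldWeight_eq]
  have h : 3 * (3 : ℝ) ^ d + 1 ≤ 4 ^ d + 3 * 2 ^ d := by
    induction d with
    | zero => norm_num
    | succ d ih =>
      have e : (4 : ℝ) ^ d = (2 ^ d) ^ 2 := by rw [← pow_mul, mul_comm, pow_mul]; norm_num
      have h2 : (0 : ℝ) ≤ (2 ^ d - 1) * (2 ^ d - 2) := by
        rcases d with _ | d
        · norm_num
        · have : (1 : ℝ) ≤ 2 ^ d := one_le_pow₀ (by norm_num)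
          rw [pow_succ]
          nlinarith
      simp only [pow_succ]
      nlinarith
  have h4 : (0 : ℝ) < 4 ^ d := by positivity
  have h' : 3 * (3 / 4 : ℝ) ^ d - 3 * (1 / 2) ^ d + (1 / 4) ^ d ≤ 1 := by
    have e : (1 / 2 : ℝ) ^ d = 2 ^ d / 4 ^ d := by rw [← div_pow]; norm_num
    rw [e, div_pow, div_pow, one_pow]
    have : 3 * (3 ^ d / 4 ^ d) - 3 * (2 ^ d / 4 ^ d) + 1 / 4 ^ d
      = (3 * (3 : ℝ) ^ d - 3 * 2 ^ d + 1) / 4 ^ d := by ring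
    rw [this, div_le_one h4]
    linarith
  nlinarith

end Weight

section Free

variable {V : Type*} [Fintype V]

/-- The indicator function of the event that the colours in `S v` are not forbidden at `v`. -/
noncomputable def freeInd (S : V → Finset (Fin 3)) (p : Config V) : ℝ :=
  ∏ v, if ∀ a ∈ S v, p.2 v a = 0 then 1 else 0

theorem sum_freeCoeff_mul_ite (θ : ℝ) (x : Fin 3 → ℕ) :
    ∑ T : Finset (Fin 3), freeCoeff θ T * (if ∀ a ∈ T, x a = 0 then 1 else 0) =
      if ∃ a, x a = 0 then 1 else θ := by
  rw [sum_freeCoeff_mul]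
  by_cases h0 : x 0 = 0 <;> by_cases h1 : x 1 = 0 <;> by_cases h2 : x 2 = 0 <;>
    simp [h0, h1, h2, Fin.exists_fin_succ]

theorem pow_minEnergy_le {θ : ℝ} (h0 : 0 ≤ θ) (h1 : θ ≤ 1) (p : Config V) :
    θ ^ minEnergy p ≤ ∏ v, if ∃ a, p.2 v a = 0 then 1 else θ := by
  obtain ⟨σ, hσ⟩ := exists_energy_eq_minEnergy p
  rw [← hσ, energy]
  refine (pow_le_pow_of_le_one h0 h1 (Nat.le_add_left _ _)).trans ?_
  rw [← Finset.prod_pow_eq_pow_sum]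
  refine Finset.prod_le_prod (fun v _ => by positivity) fun v _ => ?_
  split_ifs with h
  · exact pow_le_one₀ h0 h1
  · push Not at h
    exact pow_le_of_le_one h0 h1 (h _)

namespace State

/-- The expectations of `freeInd S` are those of the state with `k v` random fields at `v`. -/
def HasDegrees (s : State V) (k : V → ℕ) : Prop :=
  ∀ S, s.toFun (freeInd S) = ∏ v, (1 - (S v).card / 4 : ℝ) ^ k v

theorem hasDegrees_dirac_zero : (dirac (0 : Config V)).HasDegrees 0 := fun S => by
  simp [dirac, freeInd]

end State

variable [DecidableEq V]

theorem prod_ite_free_eq (θ : ℝ) (p : Config V) :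
    (∏ v, if ∃ a, p.2 v a = 0 then 1 else θ) =
      ∑ S : V → Finset (Fin 3), (∏ v, freeCoeff θ (S v)) * freeInd S p := by
  simp only [← sum_freeCoeff_mul_ite, Finset.prod_univ_sum, Fintype.piFinset_univ, freeInd,
    Finset.prod_mul_distrib]

theorem freeInd_add_fieldCost (S : V → Finset (Fin 3)) (p : Config V) (i : V) (a : Fin 3) :
    freeInd S (p + fieldCost i a) = if a ∈ S i then 0 else freeInd S p := by
  split_ifs with h
  · refine Finset.prod_eq_zero (Finset.mem_univ i) (if_neg fun h' => ?_)
    simpa [fieldCost] using h' a h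
  · refine Finset.prod_congr rfl fun v _ => ?_
    congr 1
    refine propext (forall₂_congr fun b hb => ?_)
    have : (fieldCost i a).2 v b = 0 := by
      by_cases hv : v = i
      · subst hv
        have : b ≠ a := fun hba => h (hba ▸ hb)
        simp [fieldCost, this]
      · simp [fieldCost, hv]
    simp [this]

theorem fieldOp_freeInd (i : V) (S : V → Finset (Fin 3)) :
    fieldOp i (freeInd S) = (1 - (S i).card / 4 : ℝ) • freeInd S := by
  ext p
  simp only [fieldOp_apply, freeInd_add_fieldCost, Pi.smul_apply, smul_eq_mul]
  have : ∑ a, (if a ∈ S i then 0 else freeInd S p) = (3 - (S i).card) * freeInd S p := by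
    have h := Finset.sum_add_distrib (s := Finset.univ)
      (f := fun a => if a ∈ S i then 0 else freeInd S p)
      (g := fun a => if a ∈ S i then freeInd S p else 0)
    have h1 : ∀ a, ((if a ∈ S i then 0 else freeInd S p) + if a ∈ S i then freeInd S p else 0)
        = freeInd S p := fun a => by split_ifs <;> simp
    simp only [h1, Finset.sum_const, Finset.card_univ, Fintype.card_fin, nsmul_eq_mul,
      Finset.sum_ite_mem, Finset.univ_inter] at h
    push_cast at h
    linarith
  rw [this]
  ring

namespace State

theorem HasDegrees.addField {s : State V} {k : V → ℕ} (h : s.HasDegrees k) (i : V) :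
    (addField i s).HasDegrees (k + Pi.single i 1) := fun S => by
  change s.toFun (fieldOp i (freeInd S)) = _
  rw [fieldOp_freeInd, map_smul, h, smul_eq_mul]
  simp only [Pi.add_apply, pow_add, Finset.prod_mul_distrib]
  rw [mul_comm]
  congr 1
  rw [Finset.prod_eq_single i (fun v _ hv => by simp [hv]) (by simp)]
  simp

theorem HasDegrees.logPartition_le {θ : ℝ} (h0 : 0 < θ) (h1 : θ ≤ 1) {s : State V} {k : V → ℕ}
    (h : s.HasDegrees k) : logPartition θ s ≤ ∑ v, Real.log (fieldWeight θ (k v)) := by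
  rw [← Real.log_prod fun v _ => (fieldWeight_pos h0 h1 (k v)).ne']
  refine Real.log_le_log (s.pos' θ h0 h1) ?_
  have e : ∏ v, fieldWeight θ (k v) = s.toFun
      (∑ S : V → Finset (Fin 3), (∏ v, freeCoeff θ (S v)) • freeInd S) := by
    simp only [fieldWeight, Finset.prod_univ_sum, Fintype.piFinset_univ, map_sum, map_smul, h _,
      smul_eq_mul, Finset.prod_mul_distrib]
  rw [e]
  refine s.mono fun p => (pow_minEnergy_le h0.le h1 p).trans_eq ?_
  simp only [prod_ite_free_eq, Finset.sum_apply, Pi.smul_apply, smul_eq_mul]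

end State

/-- The operator behind the binomial distribution. -/
theorem avgOp_ite_pow_apply_zero (v : V) (f : ℕ → ℝ) (N : ℕ) :
    (avgOp (fun i d => if v = i then d + 1 else d) ^ N) f 0 =
      ∑ d ∈ Finset.range (N + 1), N.choose d * (Fintype.card V : ℝ)⁻¹ ^ d *
        (1 - (Fintype.card V : ℝ)⁻¹) ^ (N - d) * f d := by
  set n : ℝ := (Fintype.card V : ℝ)
  have hn : n ≠ 0 := Nat.cast_ne_zero.2 (Fintype.card_pos_iff.2 ⟨v⟩).ne'
  set T : Module.End ℝ (ℕ → ℝ) := LinearMap.funLeft ℝ ℝ Nat.succ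
  have hT : ∀ k f d, (T ^ k) f d = f (d + k) := by
    intro k
    induction k with
    | zero => simp
    | succ k ih =>
      intro f d
      rw [pow_succ, Module.End.mul_apply, ih]
      rfl
  have e : avgOp (fun i d => if v = i then d + 1 else d) = n⁻¹ • T + (1 - n⁻¹) • 1 := by
    ext f d
    have h : ∀ i, f (if v = i then d + 1 else d) = (if v = i then f (d + 1) - f d else 0) + f d :=
      fun i => by split_ifs <;> simp
    simp only [avgOp_apply, h, Finset.sum_add_distrib, Finset.sum_ite_eq, Finset.mem_univ, if_true,
      Finset.sum_const, Finset.card_univ, nsmul_eq_mul, LinearMap.add_apply, LinearMap.smul_apply,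
      Pi.add_apply, Pi.smul_apply, Module.End.one_apply, smul_eq_mul]
    change n⁻¹ * (f (d + 1) - f d + n * f d) = n⁻¹ * f (d + 1) + _
    field_simp
    ring
  rw [e, (((Commute.one_right T).smul_left _).smul_right _).add_pow]
  simp only [smul_pow, one_pow, LinearMap.sum_apply, Finset.sum_apply, Module.End.mul_apply,
    LinearMap.smul_apply, Pi.smul_apply, smul_eq_mul]
  refine Finset.sum_congr rfl fun d _ => ?_
  rw [hT]
  simp [Module.End.natCast_apply]
  ring

theorem avgOp_addField_pow_logPartition_le {θ : ℝ} (h0 : 0 < θ) (h1 : θ ≤ 1) (N D : ℕ) :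
    (avgOp State.addField ^ N) (State.logPartition θ) (State.dirac (0 : Config V)) ≤
      Fintype.card V * ∑ d ∈ Finset.range D, N.choose d * (Fintype.card V : ℝ)⁻¹ ^ d *
        (1 - (Fintype.card V : ℝ)⁻¹) ^ (N - d) * Real.log (fieldWeight θ d) := by
  have key := avgOp_pow_le_of_rel (t := State.addField)
    (t' := fun (i : V) (k : V → ℕ) => k + Pi.single i 1) (fun s k => s.HasDegrees k)
    (fun i s k h => h.addField i) (fun s k h => h.logPartition_le h0 h1) N
    (State.hasDegrees_dirac_zero (V := V))
  refine key.trans ?_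
  have e : (fun k : V → ℕ => ∑ v, Real.log (fieldWeight θ (k v)))
      = ∑ v, fun k : V → ℕ => Real.log (fieldWeight θ (k v)) := by
    ext k
    simp
  rw [e, map_sum, Finset.sum_apply]
  refine (Finset.sum_le_card_nsmul _ _ _ fun v _ => ?_).trans_eq (nsmul_eq_mul _ _)
  refine (avgOp_pow_le_of_rel (t' := fun i d => if v = i then d + 1 else d)
    (Ψ' := fun d => Real.log (fieldWeight θ d)) (fun k d => k v = d) ?_ ?_ N rfl).trans ?_
  · rintro i k _ rfl
    by_cases h : v = i <;> simp [h]
  · rintro k _ rfl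
    rfl
  · have hle : ∀ d, (N.choose d * (Fintype.card V : ℝ)⁻¹ ^ d *
        (1 - (Fintype.card V : ℝ)⁻¹) ^ (N - d) * Real.log (fieldWeight θ d)) ≤ 0 := by
      intro d
      have h2 : (0 : ℝ) ≤ 1 - (Fintype.card V : ℝ)⁻¹ := sub_nonneg.2 <|
        inv_le_one_of_one_le₀ (Nat.one_le_cast.2 (Fintype.card_pos_iff.2 ⟨v⟩))
      exact mul_nonpos_of_nonneg_of_nonpos (by positivity)
        (Real.log_nonpos (fieldWeight_pos h0 h1 d).le (fieldWeight_le_one h1 d))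
    rw [Pi.zero_apply, avgOp_ite_pow_apply_zero]
    have h3 : ∀ m, ∑ d ∈ Finset.range (m + (N + 1)), (N.choose d * (Fintype.card V : ℝ)⁻¹ ^ d *
        (1 - (Fintype.card V : ℝ)⁻¹) ^ (N - d) * Real.log (fieldWeight θ d)) =
        ∑ d ∈ Finset.range (N + 1), (N.choose d * (Fintype.card V : ℝ)⁻¹ ^ d *
        (1 - (Fintype.card V : ℝ)⁻¹) ^ (N - d) * Real.log (fieldWeight θ d)) := by
      intro m
      refine (Finset.sum_subset (Finset.range_mono (by omega)) fun d _ hd => ?_).symm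
      rw [Nat.choose_eq_zero_of_lt (by simpa using hd)]
      simp
    rw [← h3 D]
    refine Finset.sum_le_sum_of_subset_of_nonpos' ?_ ?_
    · exact Finset.range_mono (by omega)
    · exact fun d _ _ => hle d

end Free

section Edges

variable {V : Type*} [Fintype V]

/-- Add the cost of an edge. -/
def edgeStep (e : V × V) (p : Config V) : Config V := p + edgeCost e.1 e.2

/-- The expected smallest cost after `N` lazy steps of adding random edges. -/
noncomputable def meanMinEnergy (V : Type*) [Fintype V] (N : ℕ) : ℝ :=
  (avgOp (lazyStep edgeStep) ^ N) (fun p : Config V => (minEnergy p : ℝ)) 0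

theorem log_mul_meanMinEnergy_le (θ : ℝ) (N : ℕ) :
    Real.log θ * meanMinEnergy V N ≤
      (avgOp (lazyStep State.addEdge) ^ N) (State.logPartition θ) (State.dirac (0 : Config V)) := by
  have e : Real.log θ * meanMinEnergy V N = (avgOp (lazyStep edgeStep) ^ N)
      (Real.log θ • fun p : Config V => (minEnergy p : ℝ)) 0 := by
    rw [map_smul]
    rfl
  rw [e]
  refine avgOp_pow_le_of_rel (fun p s => s = State.dirac p) ?_ ?_ N rfl
  · rintro ⟨_ | _, e⟩ p _ rfl
    · rfl
    · rfl
  · rintro p _ rfl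
    change _ ≤ Real.log (θ ^ minEnergy p)
    rw [Real.log_pow, Pi.smul_apply, smul_eq_mul, mul_comm]

theorem le_neg_log_mul_meanMinEnergy [Nonempty V] {θ : ℝ} (h0 : 0 < θ) (h1 : θ < 1) (N D : ℕ) :
    N / 2 * Real.log (1 - (1 - θ) * (3 / 16)) -
      Fintype.card V * ∑ d ∈ Finset.range D, N.choose d * (Fintype.card V : ℝ)⁻¹ ^ d *
        (1 - (Fintype.card V : ℝ)⁻¹) ^ (N - d) * Real.log (fieldWeight θ d) ≤
      -Real.log θ * meanMinEnergy V N := by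
  classical
  have ha := log_mul_meanMinEnergy_le (V := V) θ N
  have hb := avgOp_pow_le_avgOp_pow_sub (t := lazyStep State.addEdge)
    (t' := State.addField (V := V)) (by
      rintro ⟨_ | _, e⟩ i s
      · rfl
      · exact State.addEdge_addField e i s) (State.logPartition_interpolation h0 h1) N
      (State.dirac 0)
  have hc := avgOp_addField_pow_logPartition_le (V := V) h0 h1.le N D
  linarith

open Classical in
/-- The indicator function of the existence of a colouring of cost `0`. -/
noncomputable def satInd (p : Config V) : ℝ := if minEnergy p = 0 then 1 else 0

theorem satInd_nonneg (p : Config V) : 0 ≤ satInd p := by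
  unfold satInd; split_ifs <;> simp

theorem satInd_edgeStep_le (e : V × V) (p : Config V) : satInd (edgeStep e p) ≤ satInd p := by
  unfold satInd
  have := minEnergy_le_minEnergy_add p (edgeCost e.1 e.2)
  split_ifs with h h'
  · rfl
  · exact absurd (Nat.le_zero.1 (h ▸ this)) h'
  · exact zero_le_one
  · rfl

theorem avgOp_edgeStep_satInd_le [Nonempty V] (p : Config V) :
    avgOp edgeStep satInd p ≤ satInd p := by
  calc avgOp edgeStep satInd p ≤ avgOp (edgeStep (V := V)) (fun _ => satInd p) p := by
        simp only [avgOp_apply]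
        gcongr
        exact satInd_edgeStep_le _ _
    _ = satInd p := by rw [avgOp_const]

theorem avgOp_satInd_mul_sq_le [Nonempty V] (N : ℕ) :
    (avgOp (lazyStep edgeStep) ^ N) (satInd (V := V)) 0 * meanMinEnergy V N ^ 2 ≤ N := by
  set h := meanMinEnergy V N with hh
  set A := avgOp (lazyStep (edgeStep (V := V))) ^ N
  set H : Config V → ℝ := fun p => (minEnergy p : ℝ)
  have hvar : A (fun p => H p ^ 2) 0 ≤ h ^ 2 + N := by
    refine avgOp_pow_sq_sub_sq_le ?_ ?_ ?_ N 0
    · rintro ⟨_ | _, e⟩ ⟨_ | _, e'⟩ p <;> try rfl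
      exact add_right_comm _ _ _
    · rintro ⟨_ | _, e⟩ p
      · exact le_rfl
      · exact Nat.cast_le.2 (minEnergy_le_minEnergy_add _ _)
    · rintro ⟨_ | _, e⟩ p
      · exact le_add_of_nonneg_right zero_le_one
      · change ((minEnergy (p + edgeCost e.1 e.2) : ℕ) : ℝ) ≤ (minEnergy p : ℕ) + 1
        exact_mod_cast minEnergy_add_le p (energy_edgeCost_le e.1 e.2)
  have hle : A (h ^ 2 • satInd) 0 ≤
      A ((fun p => H p ^ 2) + (-2 * h) • H + h ^ 2 • fun _ => 1) 0 := by
    refine avgOp_pow_mono _ (fun p => ?_) N 0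
    simp only [Pi.add_apply, Pi.smul_apply, smul_eq_mul, satInd]
    split_ifs with h0
    · simp [H, h0]
    · nlinarith [sq_nonneg (H p - h)]
  have h1 : A (fun _ => 1) = fun _ => 1 := avgOp_pow_const _ 1 N
  have hH : A H 0 = h := rfl
  simp only [map_add, map_smul, Pi.add_apply, Pi.smul_apply, smul_eq_mul, h1, hH] at hle
  linarith

theorem avgOp_add_pow_apply {ι S : Type*} [Fintype ι] [AddCommMonoid S] (c : ι → S) (Ψ : S → ℝ)
    (m : ℕ) (s : S) :
    (avgOp (fun i s => s + c i) ^ m) Ψ s =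
      (Fintype.card ι : ℝ)⁻¹ ^ m * ∑ G : Fin m → ι, Ψ (s + ∑ j, c (G j)) := by
  induction m generalizing s with
  | zero => simp
  | succ m ih =>
    rw [pow_succ', Module.End.mul_apply, avgOp_apply]
    simp only [ih]
    rw [← Finset.mul_sum, ← mul_assoc, ← pow_succ', ← Fintype.sum_prod_type',
      ← (Fin.consEquiv fun _ : Fin (m + 1) => ι).sum_comp]
    simp [Fin.consEquiv, Fin.sum_univ_succ, add_assoc]

theorem energy_sum {ι : Type*} (s : Finset ι) (f : ι → Config V) (σ : V → Fin 3) :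
    energy (∑ i ∈ s, f i) σ = ∑ i ∈ s, energy (f i) σ := by
  classical
  induction s using Finset.induction_on with
  | empty => simp [energy]
  | insert a s ha ih => rw [Finset.sum_insert ha, Finset.sum_insert ha, energy_add, ih]

theorem minEnergy_sum_edgeCost_eq_zero_iff {m : ℕ} (G : Fin m → V × V) :
    minEnergy (∑ e, edgeCost (G e).1 (G e).2) = 0 ↔
      ∃ σ : V → Fin 3, ∀ e, σ (G e).1 ≠ σ (G e).2 := by
  have h : ∀ σ, energy (∑ e, edgeCost (G e).1 (G e).2) σ = 0 ↔ ∀ e, σ (G e).1 ≠ σ (G e).2 := by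
    intro σ
    simp [energy_sum, energy_edgeCost]
  simp only [← h]
  constructor
  · intro h0
    obtain ⟨σ, hσ⟩ := exists_energy_eq_minEnergy (∑ e, edgeCost (G e).1 (G e).2)
    exact ⟨σ, hσ.trans h0⟩
  · rintro ⟨σ, hσ⟩
    exact Nat.le_zero.1 (hσ ▸ minEnergy_le _ σ)

end Edges

theorem card_proper_div_eq (n m : ℕ) :
    (Nat.card {G : Fin m → Fin n × Fin n // ∃ σ : Fin n → Fin 3, Proper G σ} : ℝ) /
        (n : ℝ) ^ (2 * m) = (avgOp edgeStep ^ m) (satInd (V := Fin n)) 0 := by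
  classical
  have h := avgOp_add_pow_apply (fun e : Fin n × Fin n => edgeCost e.1 e.2) satInd m 0
  change (avgOp edgeStep ^ m) (satInd (V := Fin n)) 0 = _ at h
  simp only [h, zero_add, satInd, minEnergy_sum_edgeCost_eq_zero_iff, Finset.sum_boole,
    Nat.card_eq_fintype_card, Fintype.card_subtype, Fintype.card_prod, Fintype.card_fin, Proper]
  rw [div_eq_inv_mul, pow_mul, sq, ← inv_pow, Nat.cast_mul]

theorem card_proper_div_mul_sq_le {n m M : ℕ} (hn : n ≠ 0) (hM : M ≤ m) :
    (Nat.card {G : Fin m → Fin n × Fin n // ∃ σ : Fin n → Fin 3, Proper G σ} : ℝ) /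
        (n : ℝ) ^ (2 * m) * meanMinEnergy (Fin n) (2 * M + 1) ^ 2 ≤ 2 * (2 * M + 1) := by
  have : Nonempty (Fin n) := Fin.pos_iff_nonempty.1 (Nat.pos_of_ne_zero hn)
  rw [card_proper_div_eq]
  have h1 := avgOp_pow_antitone (avgOp_edgeStep_satInd_le (V := Fin n)) 0 hM
  have h2 := avgOp_pow_le_two_mul_lazyStep (satInd_nonneg (V := Fin n)) avgOp_edgeStep_satInd_le M 0
  have h3 := avgOp_satInd_mul_sq_le (V := Fin n) (2 * M + 1)
  push_cast at h3
  calc _ ≤ 2 * (avgOp (lazyStep edgeStep) ^ (2 * M + 1)) satInd 0 *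
        meanMinEnergy (Fin n) (2 * M + 1) ^ 2 :=
        mul_le_mul_of_nonneg_right (h1.trans h2) (sq_nonneg _)
    _ ≤ _ := by linarith

section Numerics

theorem log_le_neg_div_of_pow_mul_le_one {x : ℝ} (hx : 0 < x) {a b : ℕ} (hb : b ≠ 0)
    (h : x ^ b * 2.7182818286 ^ a ≤ 1) : Real.log x ≤ -(a / b) := by
  have he : x ^ b * Real.exp 1 ^ a ≤ 1 :=
    le_trans (by gcongr; exact Real.exp_one_lt_d9.le) h
  have h1 := Real.log_nonpos (by positivity) he
  rw [Real.log_mul (by positivity) (by positivity), Real.log_pow, Real.log_pow, Real.log_exp] at h1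
  have hb' : (0 : ℝ) < b := by positivity
  rw [← neg_div, le_div_iff₀ hb']
  linarith

theorem neg_div_le_log_of_one_le_pow_mul {x : ℝ} (hx : 0 < x) {a b : ℕ} (hb : b ≠ 0)
    (h : 1 ≤ x ^ b * 2.7182818283 ^ a) : -(a / b) ≤ Real.log x := by
  have he : 1 ≤ x ^ b * Real.exp 1 ^ a :=
    h.trans (by gcongr; exact Real.exp_one_gt_d9.le)
  have h1 := Real.log_nonneg he
  rw [Real.log_mul (by positivity) (by positivity), Real.log_pow, Real.log_pow, Real.log_exp] at h1
  have hb' : (0 : ℝ) < b := by positivity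
  rw [← neg_div, div_le_iff₀ hb']
  linarith

theorem log_fieldWeight_le {d : ℕ} (a : ℕ) {u : ℝ}
    (hu : 1 / 1000 + (1 - 1 / 1000) * (3 * (3 / 4) ^ d - 3 * (1 / 2) ^ d + (1 / 4) ^ d) ≤ u)
    (h : u ^ 100 * 2.7182818286 ^ a ≤ 1) :
    Real.log (fieldWeight (1 / 1000) d) ≤ -(a / 100) := by
  rw [← fieldWeight_eq] at hu
  have hpos := fieldWeight_pos (θ := 1 / 1000) (by norm_num) (by norm_num) d
  exact (Real.log_le_log hpos hu).trans <| by
    simpa using log_le_neg_div_of_pow_mul_le_one (hpos.trans_le hu) (b := 100) (by norm_num) h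

/-- The numerical inequality on which the threshold rests. -/
theorem sum_poisson_mul_log_fieldWeight_lt :
    ∑ d ∈ Finset.range 13, 4.92 ^ d / d.factorial * Real.exp (-4.92) *
        Real.log (fieldWeight (1 / 1000) d) <
      4.92 / 2 * Real.log (1 - (1 - 1 / 1000) * (3 / 16)) := by
  have hexp : 0.00728 ≤ Real.exp (-4.92) := by
    rw [← Real.log_le_iff_le_exp (by norm_num)]
    have := log_le_neg_div_of_pow_mul_le_one (x := 0.00728) (a := 123) (b := 25) (by norm_num)
      (by norm_num) (by norm_num)
    norm_num at this ⊢
    linarith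
  have hK : -(26 / 125) ≤ Real.log (1 - (1 - 1 / 1000) * (3 / 16)) := by
    simpa using neg_div_le_log_of_one_le_pow_mul (x := 1 - (1 - 1 / 1000) * (3 / 16)) (a := 26)
      (b := 125) (by norm_num) (by norm_num) (by norm_num)
  have h0 (d : ℕ) := Real.log_nonpos
    (fieldWeight_pos (θ := 1 / 1000) (by norm_num) (by norm_num) d).le
    (fieldWeight_le_one (by norm_num) d)
  have h3 := log_fieldWeight_le (d := 3) 9 (u := 0.9064) (by norm_num) (by norm_num)
  have h4 := log_fieldWeight_le (d := 4) 26 (u := 0.7659) (by norm_num) (by norm_num)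
  have h5 := log_fieldWeight_le (d := 5) 47 (u := 0.6196) (by norm_num) (by norm_num)
  have h6 := log_fieldWeight_le (d := 6) 71 (u := 0.4879) (by norm_num) (by norm_num)
  have h7 := log_fieldWeight_le (d := 7) 97 (u := 0.3777) (by norm_num) (by norm_num)
  have h8 := log_fieldWeight_le (d := 8) 124 (u := 0.28935) (by norm_num) (by norm_num)
  have h9 := log_fieldWeight_le (d := 9) 151 (u := 0.2202) (by norm_num) (by norm_num)
  have h10 := log_fieldWeight_le (d := 10) 179 (u := 0.1669) (by norm_num) (by norm_num)
  have h11 := log_fieldWeight_le (d := 11) 207 (u := 0.12612) (by norm_num) (by norm_num)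
  have h12 := log_fieldWeight_le (d := 12) 235 (u := 0.0953) (by norm_num) (by norm_num)
  have hsum : ∑ d ∈ Finset.range 13, 4.92 ^ d / (d.factorial : ℝ) *
      Real.log (fieldWeight (1 / 1000) d) ≤ -71.5 := by
    have h0' := h0 0
    have h1' := h0 1
    have h2' := h0 2
    simp only [Finset.sum_range_succ, Finset.sum_range_zero, Nat.factorial]
    norm_num at *
    linarith
  have e : ∑ d ∈ Finset.range 13, 4.92 ^ d / (d.factorial : ℝ) * Real.exp (-4.92) *
      Real.log (fieldWeight (1 / 1000) d) = Real.exp (-4.92) *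
      ∑ d ∈ Finset.range 13, 4.92 ^ d / (d.factorial : ℝ) *
        Real.log (fieldWeight (1 / 1000) d) := by
    rw [Finset.mul_sum]
    exact Finset.sum_congr rfl fun _ _ => by ring
  rw [e]
  nlinarith

end Numerics

section Limit

/-- The Poisson limit of the binomial distributions with parameters `N n` and `1 / n`. -/
theorem tendsto_choose_mul_inv_pow {N : ℕ → ℕ} {D : ℝ} (hD : 0 < D)
    (hN : Tendsto (fun n => (N n : ℝ) / n) atTop (nhds D)) (d : ℕ) :
    Tendsto (fun n : ℕ => (N n).choose d * (n : ℝ)⁻¹ ^ d * (1 - (n : ℝ)⁻¹) ^ (N n - d)) atTop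
      (nhds (D ^ d / d.factorial * Real.exp (-D))) := by
  have hNtop : Tendsto N atTop atTop := by
    rw [← tendsto_natCast_atTop_iff (R := ℝ)]
    refine (hN.pos_mul_atTop hD tendsto_natCast_atTop_atTop).congr' ?_
    filter_upwards [eventually_ne_atTop 0] with n hn
    field_simp
  have hchoose : Tendsto (fun n : ℕ => (N n).choose d * (n : ℝ)⁻¹ ^ d) atTop
      (nhds (D ^ d / d.factorial)) := by
    have h := ((isEquivalent_choose d).comp_tendsto hNtop).mul
      (Asymptotics.IsEquivalent.refl (u := fun n : ℕ => (n : ℝ)⁻¹ ^ d))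
    refine h.symm.tendsto_nhds ?_
    refine ((hN.pow d).div_const _).congr fun n => ?_
    simp only [Function.comp_apply, Pi.mul_apply, div_eq_mul_inv, mul_pow]
    ring
  have hinv : Tendsto (fun n : ℕ => 1 - (n : ℝ)⁻¹) atTop (nhds 1) := by
    simpa using tendsto_const_nhds.sub (tendsto_inv_atTop_nhds_zero_nat (𝕜 := ℝ))
  have hpow : Tendsto (fun n : ℕ => (1 - (n : ℝ)⁻¹) ^ N n) atTop (nhds (Real.exp (-D))) := by
    have hl : Tendsto (fun n : ℕ => n * Real.log (1 + -1 / n)) atTop (nhds (-1)) :=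
      (Real.tendsto_mul_log_one_add_div_atTop (-1)).comp tendsto_natCast_atTop_atTop
    have := (Real.continuous_exp.tendsto _).comp (hN.mul hl)
    rw [mul_neg_one] at this
    refine this.congr' ?_
    filter_upwards [eventually_gt_atTop 1] with n hn
    have hn' : (1 : ℝ) < n := Nat.one_lt_cast.2 hn
    have hpos : 0 < 1 - (n : ℝ)⁻¹ := sub_pos.2 (inv_lt_one_of_one_lt₀ hn')
    have e : (N n : ℝ) / n * (n * Real.log (1 + -1 / n)) = N n * Real.log (1 - (n : ℝ)⁻¹) := by
      rw [neg_div, one_div, ← sub_eq_add_neg]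
      field_simp
    rw [Function.comp_apply, e, ← Real.log_pow, Real.exp_log (pow_pos hpos _)]
  refine hchoose.mul ?_
  have := hpow.div (hinv.pow d) (by simp)
  rw [one_pow, div_one] at this
  refine this.congr' ?_
  filter_upwards [eventually_gt_atTop 1, hNtop.eventually_ge_atTop d] with n hn hd
  have hn' : (1 : ℝ) < n := Nat.one_lt_cast.2 hn
  have hpos : 0 < 1 - (n : ℝ)⁻¹ := sub_pos.2 (inv_lt_one_of_one_lt₀ hn')
  rw [Pi.div_apply, div_eq_iff (pow_pos hpos d).ne', ← pow_add, Nat.sub_add_cancel hd]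

end Limit

/-- For every real `c ≥ 2.468155` and every sequence `(m_n)` with `m_n / n → c`,
the probability that a uniformly random multigraph `G : Fin (m n) → Fin n × Fin n`
admits a proper 3-colouring tends to `0`. -/
theorem stmt0 (c : ℝ) (hc : 2.468155 ≤ c) (m : ℕ → ℕ)
    (hm : Tendsto (fun n => (m n : ℝ) / n) atTop (nhds c)) :
    Tendsto (fun n =>
      (Nat.card {G : Fin (m n) → Fin n × Fin n // ∃ σ : Fin n → Fin 3, Proper G σ} : ℝ) /
        (n : ℝ) ^ (2 * m n))
      atTop (nhds 0) := by
  set M : ℕ → ℕ := fun n => ⌊(2.46 : ℝ) * n⌋₊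
  set N : ℕ → ℕ := fun n => 2 * M n + 1
  have hM : ∀ᶠ n in atTop, M n ≤ m n := by
    filter_upwards [hm.eventually_const_lt (u := 2.46) (by linarith), eventually_gt_atTop 0]
      with n h hn
    have hn' : (0 : ℝ) < n := Nat.cast_pos.2 hn
    rw [lt_div_iff₀ hn'] at h
    exact Nat.cast_le.1 ((Nat.floor_le (by positivity)).trans h.le)
  have hinv := tendsto_inv_atTop_nhds_zero_nat (𝕜 := ℝ)
  have hN : Tendsto (fun n => (N n : ℝ) / n) atTop (nhds 4.92) := by
    have h := (tendsto_nat_floor_mul_div_atTop (R := ℝ) (a := 2.46) (by norm_num)).comp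
      tendsto_natCast_atTop_atTop
    have h2 := (h.const_mul 2).add hinv
    rw [show (2 * 2.46 + 0 : ℝ) = 4.92 by norm_num] at h2
    refine h2.congr fun n => ?_
    simp only [N, M, Function.comp_apply]
    push_cast
    ring
  set K : ℝ := Real.log (1 - (1 - 1 / 1000) * (3 / 16))
  set C : ℝ := -Real.log (1 / 1000)
  set b : ℕ → ℝ := fun n => N n / n / 2 * K - ∑ d ∈ Finset.range 13,
    (N n).choose d * (n : ℝ)⁻¹ ^ d * (1 - (n : ℝ)⁻¹) ^ (N n - d) *
      Real.log (fieldWeight (1 / 1000) d)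
  obtain ⟨ℓ, hℓ, hb⟩ : ∃ ℓ > 0, Tendsto b atTop (nhds ℓ) :=
    ⟨_, sub_pos.2 sum_poisson_mul_log_fieldWeight_lt, ((hN.div_const 2).mul_const K).sub
      (tendsto_finsetSum _ fun d _ =>
        (tendsto_choose_mul_inv_pow (by norm_num) hN d).mul_const _)⟩
  have hlim : Tendsto (fun n : ℕ => 2 * C ^ 2 * (N n / n) * (n : ℝ)⁻¹ / b n ^ 2) atTop
      (nhds 0) := by
    have h := ((hN.const_mul (2 * C ^ 2)).mul hinv).div (hb.pow 2) (pow_pos hℓ 2).ne'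
    rwa [mul_zero, zero_div] at h
  refine tendsto_of_tendsto_of_tendsto_of_le_of_le' tendsto_const_nhds hlim
    (Eventually.of_forall fun n => by positivity) ?_
  filter_upwards [hM, eventually_gt_atTop 0, hb.eventually_const_lt hℓ] with n hMn hn hbn
  have hn' : (0 : ℝ) < n := Nat.cast_pos.2 hn
  have : Nonempty (Fin n) := Fin.pos_iff_nonempty.1 hn
  have h1 := le_neg_log_mul_meanMinEnergy (V := Fin n) (θ := 1 / 1000) (by norm_num) (by norm_num)
    (N n) 13
  have h2 := card_proper_div_mul_sq_le hn.ne' hMn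
  rw [Fintype.card_fin] at h1
  set P : ℝ := (Nat.card {G : Fin (m n) → Fin n × Fin n // ∃ σ : Fin n → Fin 3, Proper G σ} : ℝ) /
    (n : ℝ) ^ (2 * m n)
  have hP : 0 ≤ P := by positivity
  have hNn : (N n : ℝ) = 2 * M n + 1 := by simp [N]
  have h3 : n * b n ≤ C * meanMinEnergy (Fin n) (N n) := by
    refine le_trans (le_of_eq ?_) h1
    have h : n * (N n / n / 2 * K) = N n / 2 * K := by field_simp
    rw [mul_sub, h]
  rw [le_div_iff₀ (pow_pos hbn 2)]
  have h4 : (n * b n) ^ 2 ≤ (C * meanMinEnergy (Fin n) (N n)) ^ 2 := by gcongr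
  rw [← hNn] at h2
  have h5 : P * (n * b n) ^ 2 ≤ 2 * C ^ 2 * N n := by
    calc P * (n * b n) ^ 2 ≤ P * (C * meanMinEnergy (Fin n) (N n)) ^ 2 := by gcongr
      _ = C ^ 2 * (P * meanMinEnergy (Fin n) (N n) ^ 2) := by ring
      _ ≤ C ^ 2 * (2 * N n) := by gcongr
      _ = _ := by ring
  calc P * b n ^ 2 = P * (n * b n) ^ 2 * ((n : ℝ)⁻¹) ^ 2 := by field_simp
    _ ≤ 2 * C ^ 2 * N n * ((n : ℝ)⁻¹) ^ 2 := by gcongr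
    _ = _ := by ring
end

section
/- There exists an absolute constant C > 0 with the following property: for all integers n ≥ 1 and m ≥ 1, every x ∈ ℕ and every ε > 0, setting λ = 2m/n and p_x = p(x,λ), the probability that a uniformly random G : Fin m → Fin n × Fin n satisfies |θ_x(G) − p_x| > ε is at most C·√(2m)·exp(−c(ε, p_x)·n), where c(ξ, η) = min( (ξ + η)·log(1 + ξ/η) − ξ , ξ²/(2η) ). -/
open Filter

/-- The Poisson probability `p(x, λ) = e^(−λ) λ^x / x!`. -/
noncomputable def poisson (lam : ℝ) (x : ℕ) : ℝ :=
  Real.exp (-lam) * lam ^ x / (Nat.factorial x)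

/-- The degree of the vertex `v` in the multigraph `G`: the number of pairs `(e, i)`
with `e : Fin m`, `i ∈ {1,2}`, such that the `i`-th component of `G e` equals `v`. -/
def deg {n m : ℕ} (G : Fin m → Fin n × Fin n) (v : Fin n) : ℕ :=
  (Finset.univ.filter fun e => (G e).1 = v).card +
    (Finset.univ.filter fun e => (G e).2 = v).card

/-- `θ_x(G)`: `1/n` times the number of vertices of `G` of degree `x`. -/
noncomputable def theta {n m : ℕ} (G : Fin m → Fin n × Fin n) (x : ℕ) : ℝ :=
  ((Finset.univ.filter fun v => deg G v = x).card : ℝ) / n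

open Finset

theorem prod_edges_eq_prod_pow_deg {R : Type*} [CommSemiring R] {n m : ℕ}
    (G : Fin m → Fin n × Fin n) (y : Fin n → R) :
    ∏ e, y (G e).1 * y (G e).2 = ∏ v, y v ^ deg G v := by
  have key : ∀ h : Fin m → Fin n, ∏ e, y (h e) = ∏ v, y v ^ (univ.filter fun e => h e = v).card :=
    fun h => by
      rw [← Finset.prod_fiberwise univ h fun e => y (h e)]
      refine prod_congr rfl fun v _ => ?_
      rw [← prod_const]
      exact prod_congr rfl fun e he => by rw [(mem_filter.mp he).2]
  simp only [deg, pow_add, prod_mul_distrib]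
  rw [key fun e => (G e).1, key fun e => (G e).2]

theorem sum_prod_pow_deg {R : Type*} [CommSemiring R] (n m : ℕ) (y : Fin n → R) :
    ∑ G : Fin m → Fin n × Fin n, ∏ v, y v ^ deg G v = (∑ v, y v) ^ (2 * m) := by
  simp only [← prod_edges_eq_prod_pow_deg]
  rw [pow_mul, sq, sum_mul_sum, ← Fintype.sum_prod_type' fun a b => y a * y b]
  rw [Finset.sum_pow', Fintype.piFinset_univ]

theorem sum_deg {n m : ℕ} (G : Fin m → Fin n × Fin n) : ∑ v, deg G v = 2 * m := by
  simp only [deg, sum_add_distrib]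
  rw [← card_eq_sum_card_fiberwise (by simp), ← card_eq_sum_card_fiberwise (by simp)]
  simp [two_mul]

/-- The number of multigraphs with a given degree sequence is a multinomial coefficient. -/
theorem card_deg_eq {n m : ℕ} (d : Fin n → ℕ) (hd : ∑ v, d v = 2 * m) :
    (univ.filter fun G : Fin m → Fin n × Fin n => deg G = d).card = Nat.multinomial univ d := by
  have h := sum_prod_pow_deg n m fun v => (MvPolynomial.X v : MvPolynomial (Fin n) ℕ)
  rw [sum_pow_eq_sum_piAntidiag] at h
  have hmon : ∀ k : Fin n → ℕ, ∏ v, (MvPolynomial.X v : MvPolynomial (Fin n) ℕ) ^ k v =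
      MvPolynomial.monomial (Finsupp.equivFunOnFinite.symm k) 1 := fun k => by
    rw [MvPolynomial.monomial_eq, Finsupp.prod_fintype _ _ (by simp)]
    simp
  simp only [hmon] at h
  have h2 := congrArg (MvPolynomial.coeff (Finsupp.equivFunOnFinite.symm d)) h
  simp only [MvPolynomial.coeff_sum, ← MvPolynomial.C_eq_coe_nat, MvPolynomial.coeff_C_mul,
    MvPolynomial.coeff_monomial, EmbeddingLike.apply_eq_iff_eq, mul_ite, mul_one, mul_zero] at h2
  rw [Finset.sum_boole, Finset.sum_ite_eq', if_pos (by simp [mem_piAntidiag, hd])] at h2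
  simpa using h2

/-- Comparison of the degree sequence with independent Poisson variables. -/
theorem sum_prod_deg_le (n m : ℕ) (f : ℕ → ℝ) (hf : ∀ k, 0 ≤ f k) {lam : ℝ} (hlam : 0 ≤ lam) :
    (∑ G : Fin m → Fin n × Fin n, ∏ v, f (deg G v)) * lam ^ (2 * m) ≤
      (2 * m).factorial * (∑ k ∈ range (2 * m + 1), f k * lam ^ k / k.factorial) ^ n := by
  have hmaps : ∀ G ∈ (univ : Finset (Fin m → Fin n × Fin n)),
      deg G ∈ piAntidiag univ (2 * m) := fun G _ => by simp [mem_piAntidiag, sum_deg]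
  have hterm : ∀ d ∈ piAntidiag (univ : Finset (Fin n)) (2 * m),
      (∑ G : Fin m → Fin n × Fin n with deg G = d, ∏ v, f (deg G v)) * lam ^ (2 * m) =
        (2 * m).factorial * ∏ v, f (d v) * lam ^ d v / (d v).factorial := fun d hd => by
    have hd' : ∑ v, d v = 2 * m := (mem_piAntidiag.mp hd).1
    have h1 : ∑ G : Fin m → Fin n × Fin n with deg G = d, ∏ v, f (deg G v) =
        Nat.multinomial univ d * ∏ v, f (d v) := by
      rw [← card_deg_eq d hd', ← nsmul_eq_mul, ← sum_const]
      exact sum_congr rfl fun G hG => by rw [(mem_filter.mp hG).2]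
    have h2 : (∏ v, ((d v).factorial : ℝ)) * Nat.multinomial univ d = (2 * m).factorial := by
      have := Nat.multinomial_spec univ d
      rw [hd'] at this
      exact_mod_cast this
    have h3 : (∏ v, ((d v).factorial : ℝ)) ≠ 0 := prod_ne_zero_iff.mpr fun v _ => by positivity
    rw [h1, prod_div_distrib, prod_mul_distrib, prod_pow_eq_pow_sum, hd', ← h2]
    field_simp
  rw [← sum_fiberwise_of_maps_to hmaps, sum_mul, sum_congr rfl hterm, ← mul_sum]
  gcongr
  have hpow := (prod_univ_sum (fun _ : Fin n => range (2 * m + 1))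
    fun _ k => f k * lam ^ k / (k.factorial : ℝ))
  rw [prod_const, card_univ, Fintype.card_fin] at hpow
  rw [hpow]
  refine sum_le_sum_of_subset_of_nonneg (fun d hd => ?_) fun d _ _ => prod_nonneg fun v _ => ?_
  · rw [Fintype.mem_piFinset]
    intro v
    rw [mem_range, Nat.lt_succ_iff, ← (mem_piAntidiag.mp hd).1]
    exact single_le_sum (fun _ _ => Nat.zero_le _) (mem_univ v)
  · have := hf (d v)
    positivity

theorem factorial_le_stirling {N : ℕ} (hN : 1 ≤ N) :
    (N.factorial : ℝ) ≤ Real.exp 1 * √N * (N / Real.exp 1) ^ N := by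
  obtain ⟨k, rfl⟩ := Nat.exists_eq_succ_of_ne_zero (Nat.one_le_iff_ne_zero.mp hN)
  have h := Stirling.stirlingSeq'_antitone (Nat.zero_le k)
  simp only [Function.comp_apply, Nat.succ_eq_add_one, zero_add, Stirling.stirlingSeq_one] at h
  rw [Stirling.stirlingSeq, div_le_iff₀ (by positivity), Real.sqrt_mul (by norm_num)] at h
  refine h.trans_eq ?_
  field_simp

theorem exp_neg_le_quadratic {t : ℝ} (ht : 0 ≤ t) : Real.exp (-t) ≤ 1 - t + t ^ 2 / 2 := by
  have h := Real.quadratic_le_exp_of_nonneg ht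
  rw [Real.exp_neg, inv_le_iff_one_le_mul₀ (Real.exp_pos t)]
  have h0 : 0 < 1 - t + t ^ 2 / 2 := by nlinarith [sq_nonneg (t - 1)]
  nlinarith [mul_le_mul_of_nonneg_left h h0.le, sq_nonneg (t ^ 2)]

theorem sum_exp_ite_le {lam : ℝ} (hlam : 0 ≤ lam) (x N : ℕ) (s : ℝ) :
    ∑ k ∈ range N, (if k = x then Real.exp s else 1) * lam ^ k / k.factorial ≤
      Real.exp lam * (1 + poisson lam x * (Real.exp s - 1)) := by
  have h1 : HasSum (fun k : ℕ => lam ^ k / (k.factorial : ℝ)) (Real.exp lam) := by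
    rw [Real.exp_eq_exp_ℝ]
    exact NormedSpace.expSeries_div_hasSum_exp lam
  have h2 : HasSum (fun k : ℕ => if k = x then (Real.exp s - 1) * (lam ^ x / x.factorial) else 0)
      ((Real.exp s - 1) * (lam ^ x / x.factorial)) := hasSum_ite_eq x _
  have h3 := h1.add h2
  have h4 : Real.exp lam + (Real.exp s - 1) * (lam ^ x / x.factorial) =
      Real.exp lam * (1 + poisson lam x * (Real.exp s - 1)) := by
    have : Real.exp lam * Real.exp (-lam) = 1 := by rw [← Real.exp_add]; simp
    rw [poisson]
    linear_combination (-(lam ^ x / x.factorial) * (Real.exp s - 1)) * this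
  rw [← h4]
  refine le_trans (le_of_eq ?_) (sum_le_hasSum (range N) (fun k _ => ?_) h3)
  · refine sum_congr rfl fun k _ => ?_
    split_ifs with hk
    · subst hk; ring
    · ring
  · split_ifs with hk
    · subst hk
      have : 0 ≤ Real.exp s * (lam ^ k / k.factorial) := by positivity
      linarith
    · positivity

theorem exp_mul_card_deg_eq_prod {n m : ℕ} (G : Fin m → Fin n × Fin n) (x : ℕ) (s : ℝ) :
    Real.exp (s * (univ.filter fun v => deg G v = x).card) =
      ∏ v, if deg G v = x then Real.exp s else 1 := by
  rw [prod_ite, prod_const, prod_const_one, mul_one, mul_comm, Real.exp_nat_mul]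

/-- Bound for the moment generating function of the number of vertices of degree `x`. -/
theorem sum_exp_card_deg_le {n m : ℕ} (hn : 1 ≤ n) (hm : 1 ≤ m) (x : ℕ) (s : ℝ) :
    (∑ G : Fin m → Fin n × Fin n, Real.exp (s * (univ.filter fun v => deg G v = x).card)) /
        (n : ℝ) ^ (2 * m) ≤
      Real.exp 1 * √(2 * m) *
        Real.exp (n * (poisson ((2 * m : ℝ) / n) x * (Real.exp s - 1))) := by
  have hn0 : (0 : ℝ) < n := by exact_mod_cast hn
  have hm0 : (0 : ℝ) < m := by exact_mod_cast hm
  set lam : ℝ := (2 * m : ℝ) / n with hlam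
  have hlam0 : 0 < lam := by positivity
  simp only [exp_mul_card_deg_eq_prod]
  have h1 := sum_prod_deg_le n m (fun k => if k = x then Real.exp s else 1)
    (fun k => by positivity) hlam0.le
  have h2 := sum_exp_ite_le hlam0.le x (2 * m + 1) s
  have h3 := factorial_le_stirling (N := 2 * m) (by omega)
  set S : ℝ := ∑ G : Fin m → Fin n × Fin n, ∏ v, if deg G v = x then Real.exp s else 1
  set p := poisson lam x
  have h4 : (∑ k ∈ range (2 * m + 1), (if k = x then Real.exp s else 1) * lam ^ k / k.factorial) ^ n
      ≤ Real.exp (2 * m) * Real.exp (n * (p * (Real.exp s - 1))) := by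
    have hle : ∑ k ∈ range (2 * m + 1), (if k = x then Real.exp s else 1) * lam ^ k / k.factorial
        ≤ Real.exp (lam + p * (Real.exp s - 1)) := by
      refine h2.trans ?_
      rw [Real.exp_add]
      gcongr
      linarith [Real.add_one_le_exp (p * (Real.exp s - 1))]
    refine (pow_le_pow_left₀ (sum_nonneg fun k _ => by positivity) hle n).trans_eq ?_
    rw [← Real.exp_nat_mul, ← Real.exp_add]
    congr 1
    rw [hlam]
    field_simp
  have h5 : S * lam ^ (2 * m) ≤ Real.exp 1 * √(2 * m) * (2 * m) ^ (2 * m) *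
      Real.exp (n * (p * (Real.exp s - 1))) := by
    refine h1.trans ((mul_le_mul h3 h4 (pow_nonneg (sum_nonneg fun k _ => by positivity) n)
      (by positivity)).trans_eq ?_)
    have : Real.exp (2 * m) = Real.exp 1 ^ (2 * m) := by
      rw [← Real.exp_nat_mul]; push_cast; ring_nf
    rw [this]
    push_cast
    rw [div_pow]
    field_simp
  rw [div_le_iff₀ (by positivity)]
  rw [hlam, div_pow, ← mul_div_assoc, div_le_iff₀ (by positivity)] at h5
  have hpos : (0 : ℝ) < (2 * m) ^ (2 * m) := by positivity
  refine le_of_mul_le_mul_right (h5.trans_eq ?_) hpos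
  ring

/-- Chernoff's method for the number of vertices of degree `x`. -/
theorem card_le_exp_of_le {n m : ℕ} (hn : 1 ≤ n) (hm : 1 ≤ m) (x : ℕ) (s t : ℝ)
    (A : Finset (Fin m → Fin n × Fin n))
    (hA : ∀ G ∈ A, n * t ≤ s * (univ.filter fun v => deg G v = x).card) :
    (A.card : ℝ) / (n : ℝ) ^ (2 * m) ≤ Real.exp 1 * √(2 * m) *
      Real.exp ((poisson ((2 * m : ℝ) / n) x * (Real.exp s - 1) - t) * n) := by
  have h1 : (A.card : ℝ) * Real.exp (n * t) ≤
      ∑ G : Fin m → Fin n × Fin n, Real.exp (s * (univ.filter fun v => deg G v = x).card) := by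
    rw [← nsmul_eq_mul, ← sum_const]
    exact (sum_le_sum fun G hG => Real.exp_le_exp.mpr (hA G hG)).trans
      (sum_le_sum_of_subset_of_nonneg (subset_univ A) fun G _ _ => (Real.exp_pos _).le)
  have hn0 : (0 : ℝ) < n := by exact_mod_cast hn
  have h2 := (div_le_div_of_nonneg_right h1 (by positivity : (0 : ℝ) ≤ (n : ℝ) ^ (2 * m))).trans
    (sum_exp_card_deg_le hn hm x s)
  rw [mul_div_right_comm, ← le_div_iff₀ (Real.exp_pos _), mul_div_assoc, ← Real.exp_sub] at h2
  refine h2.trans_eq ?_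
  ring_nf

/-- There is an absolute constant `C > 0` such that for all `n, m ≥ 1`, every `x : ℕ`
and every `ε > 0`, setting `λ = 2m/n` and `p_x = p(x, λ)`, the probability that a
uniformly random `G : Fin m → Fin n × Fin n` satisfies `|θ_x(G) − p_x| > ε` is at most
`C √(2m) exp(−c(ε, p_x) n)` where `c(ξ, η) = min((ξ+η) log(1+ξ/η) − ξ, ξ²/(2η))`. -/
theorem stmt2 :
    ∃ C : ℝ, 0 < C ∧
      ∀ (n m : ℕ), 1 ≤ n → 1 ≤ m → ∀ (x : ℕ) (ε : ℝ), 0 < ε →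
        ∀ px : ℝ, px = poisson ((2 * m : ℝ) / n) x →
          (Nat.card {G : Fin m → Fin n × Fin n // ε < |theta G x - px|} : ℝ) /
              (n : ℝ) ^ (2 * m)
            ≤ C * Real.sqrt (2 * m) *
              Real.exp (-(min ((ε + px) * Real.log (1 + ε / px) - ε)
                (ε ^ 2 / (2 * px)) * n)) := by
  refine ⟨2 * Real.exp 1, by positivity, fun n m hn hm x ε hε px hpx => ?_⟩
  have hn0 : (0 : ℝ) < n := by exact_mod_cast hn
  have hm0 : (0 : ℝ) < m := by exact_mod_cast hm
  have hp : 0 < px := by rw [hpx, poisson]; positivity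
  set c := min ((ε + px) * Real.log (1 + ε / px) - ε) (ε ^ 2 / (2 * px)) with hc
  have hK : 0 ≤ Real.exp 1 * √(2 * m) := by positivity
  have hratio : 0 < ε / px := by positivity
  have hlog : 0 < Real.log (1 + ε / px) := Real.log_pos (by linarith)
  have hup : ((univ.filter fun G : Fin m → Fin n × Fin n => px + ε < theta G x).card : ℝ) /
      (n : ℝ) ^ (2 * m) ≤ Real.exp 1 * √(2 * m) * Real.exp (-(c * n)) := by
    refine (card_le_exp_of_le hn hm x (Real.log (1 + ε / px))
      ((ε + px) * Real.log (1 + ε / px)) _ fun G hG => ?_).trans ?_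
    · have h := (mem_filter.mp hG).2
      rw [theta, lt_div_iff₀ hn0] at h
      nlinarith
    · rw [← hpx, Real.exp_log (by linarith), ← neg_mul]
      gcongr
      have h : px * (1 + ε / px - 1) = ε := by field_simp; ring
      rw [h]
      linarith [min_le_left ((ε + px) * Real.log (1 + ε / px) - ε) (ε ^ 2 / (2 * px))]
  have hlow : ((univ.filter fun G : Fin m → Fin n × Fin n => theta G x < px - ε).card : ℝ) /
      (n : ℝ) ^ (2 * m) ≤ Real.exp 1 * √(2 * m) * Real.exp (-(c * n)) := by
    refine (card_le_exp_of_le hn hm x (-(ε / px)) (-(ε / px) * (px - ε)) _ fun G hG => ?_).trans ?_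
    · have h := (mem_filter.mp hG).2
      rw [theta, div_lt_iff₀ hn0] at h
      nlinarith
    · rw [← hpx, ← neg_mul]
      gcongr
      have h := mul_le_mul_of_nonneg_left (exp_neg_le_quadratic hratio.le) hp.le
      have h' : px * (1 - ε / px + (ε / px) ^ 2 / 2) - px + ε / px * (px - ε) =
          -(ε ^ 2 / (2 * px)) := by field_simp; ring
      linarith [min_le_right ((ε + px) * Real.log (1 + ε / px) - ε) (ε ^ 2 / (2 * px))]
  have hcard : (Nat.card {G : Fin m → Fin n × Fin n // ε < |theta G x - px|} : ℝ) ≤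
      (univ.filter fun G : Fin m → Fin n × Fin n => px + ε < theta G x).card +
        (univ.filter fun G : Fin m → Fin n × Fin n => theta G x < px - ε).card := by
    classical
    rw [Nat.card_eq_fintype_card, Fintype.card_subtype]
    norm_cast
    refine (card_le_card fun G hG => ?_).trans (card_union_le _ _)
    rw [mem_union, mem_filter_univ, mem_filter_univ]
    rcases lt_abs.mp (mem_filter.mp hG).2 with h | h
    · left; linarith
    · right; linarith
  calc _ ≤ _ := div_le_div_of_nonneg_right hcard (by positivity)
    _ ≤ _ := by
      rw [add_div]
      linarith
end

section
/- Let c > 0 and let (m_n) be a sequence of natural numbers with m_n/n → c as n → ∞; set λ = 2c. Then for every fixed x ∈ ℕ and every ε > 0, the probability that a uniformly random G : Fin m_n → Fin n × Fin n satisfies |θ_x(G) − p(x,λ)| > ε tends to 0 as n → ∞. -/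
open Filter

/-- The number of functions `H : ι → α` whose fibre over `v` has exactly `x` elements. -/
lemma card_filter_card_fiber_eq {ι α : Type*} [Fintype ι] [DecidableEq ι] [Fintype α]
    [DecidableEq α] (v : α) (x : ℕ) :
    (Finset.univ.filter fun H : ι → α =>
      (Finset.univ.filter fun i => H i = v).card = x).card =
      (Fintype.card ι).choose x * (Fintype.card α - 1) ^ (Fintype.card ι - x) := by
  rw [Finset.card_eq_sum_card_fiberwise (f := fun H : ι → α => Finset.univ.filter fun i => H i = v)
    (t := Finset.powersetCard x Finset.univ)]
  · rw [Finset.sum_congr rfl (g := fun _ => (Fintype.card α - 1) ^ (Fintype.card ι - x))]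
    · simp
    · intro A hA
      rw [Finset.mem_powersetCard] at hA
      have key : ((Finset.univ.filter fun H : ι → α =>
          (Finset.univ.filter fun i => H i = v).card = x).filter fun H =>
            (Finset.univ.filter fun i => H i = v) = A) =
          Fintype.piFinset fun i => if i ∈ A then {v} else ({v} : Finset α)ᶜ := by
        ext H
        simp only [Finset.mem_filter, Finset.mem_univ, true_and, Fintype.mem_piFinset]
        constructor
        · rintro ⟨-, rfl⟩ i
          by_cases h : H i = v <;> simp [h]
        · intro h
          have h' : (Finset.univ.filter fun i => H i = v) = A := by
            ext i
            have := h i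
            by_cases hi : i ∈ A <;> simp_all
          exact ⟨h' ▸ hA.2, h'⟩
      rw [key, Fintype.card_piFinset]
      have hcard : ∀ i, (if i ∈ A then {v} else ({v} : Finset α)ᶜ).card =
          if i ∈ A then 1 else Fintype.card α - 1 := by
        intro i
        split_ifs <;> simp [Finset.card_compl]
      simp only [hcard, Finset.prod_ite, Finset.prod_const, one_pow, one_mul]
      congr 1
      rw [Finset.filter_not, Finset.card_sdiff_of_subset (Finset.filter_subset _ _)]
      simp [hA.2]
  · intro H hH
    simp only [Finset.coe_filter, Finset.mem_univ, true_and, Set.mem_ofPred_eq] at hH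
    simp [Finset.mem_powersetCard, hH]

/-- The number of functions `H : ι → α` whose fibres over two distinct points both have exactly
`x` elements. -/
lemma card_filter_card_fiber_eq_and {ι α : Type*} [Fintype ι] [DecidableEq ι] [Fintype α]
    [DecidableEq α] {v w : α} (hvw : v ≠ w) (x : ℕ) :
    (Finset.univ.filter fun H : ι → α =>
      (Finset.univ.filter fun i => H i = v).card = x ∧
      (Finset.univ.filter fun i => H i = w).card = x).card =
      (Fintype.card ι).choose x * (Fintype.card ι - x).choose x *
        (Fintype.card α - 2) ^ (Fintype.card ι - x - x) := by
  rw [Finset.card_eq_sum_card_fiberwise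
    (f := fun H : ι → α => (⟨Finset.univ.filter fun i => H i = v,
      Finset.univ.filter fun i => H i = w⟩ : (_ : Finset ι) × Finset ι))
    (t := (Finset.powersetCard x Finset.univ).sigma fun A => Finset.powersetCard x Aᶜ)]
  · rw [Finset.sum_congr rfl (g := fun _ => (Fintype.card α - 2) ^ (Fintype.card ι - x - x))]
    · rw [Finset.sum_const, Finset.card_sigma, smul_eq_mul]
      congr 1
      rw [Finset.sum_congr rfl (g := fun _ => (Fintype.card ι - x).choose x)]
      · simp
      · intro A hA
        rw [Finset.card_powersetCard, Finset.card_compl, (Finset.mem_powersetCard.1 hA).2]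
    · rintro ⟨A, B⟩ hAB
      simp only [Finset.mem_sigma, Finset.mem_powersetCard, Finset.subset_univ, true_and] at hAB
      obtain ⟨hA, hBA, hB⟩ := hAB
      have hdisj : ∀ i, i ∈ B → i ∉ A := fun i hi => Finset.mem_compl.1 (hBA hi)
      have key : ((Finset.univ.filter fun H : ι → α =>
          (Finset.univ.filter fun i => H i = v).card = x ∧
          (Finset.univ.filter fun i => H i = w).card = x).filter fun H =>
            (⟨Finset.univ.filter fun i => H i = v,
              Finset.univ.filter fun i => H i = w⟩ : (_ : Finset ι) × Finset ι) = ⟨A, B⟩) =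
          Fintype.piFinset fun i =>
            if i ∈ A then {v} else if i ∈ B then {w} else ({v, w} : Finset α)ᶜ := by
        ext H
        simp only [Finset.mem_filter, Finset.mem_univ, true_and, Fintype.mem_piFinset,
          Sigma.mk.injEq, heq_eq_eq]
        constructor
        · rintro ⟨-, rfl, rfl⟩ i
          by_cases h : H i = v
          · simp [h]
          · by_cases h' : H i = w <;> simp [h, h', hvw.symm]
        · intro h
          have h₁ : (Finset.univ.filter fun i => H i = v) = A := by
            ext i
            have := h i
            have := hdisj i
            by_cases hi : i ∈ A <;> by_cases hi' : i ∈ B <;> simp_all [hvw.symm]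
          have h₂ : (Finset.univ.filter fun i => H i = w) = B := by
            ext i
            have := h i
            have := hdisj i
            by_cases hi : i ∈ A <;> by_cases hi' : i ∈ B <;> simp_all
          exact ⟨⟨h₁ ▸ hA, h₂ ▸ hB⟩, h₁, h₂⟩
      rw [key, Fintype.card_piFinset]
      have hcard : ∀ i, (if i ∈ A then {v} else if i ∈ B then {w}
          else ({v, w} : Finset α)ᶜ).card =
          if i ∈ A ∪ B then 1 else Fintype.card α - 2 := by
        intro i
        by_cases hi : i ∈ A
        · simp [hi]
        · by_cases hi' : i ∈ B
          · simp [hi, hi']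
          · rw [if_neg hi, if_neg hi', if_neg (by simp [hi, hi']), Finset.card_compl,
              Finset.card_pair hvw]
      simp only [hcard, Finset.prod_ite, Finset.prod_const, one_pow, one_mul]
      congr 1
      rw [Finset.filter_not, Finset.card_sdiff_of_subset (Finset.filter_subset _ _)]
      have hd : Disjoint A B := Finset.disjoint_right.2 hdisj
      rw [Finset.filter_mem_eq_inter, Finset.univ_inter, Finset.card_union_of_disjoint hd, hA, hB,
        Finset.card_univ, Nat.sub_sub]
  · intro H hH
    simp only [Finset.coe_filter, Finset.mem_univ, true_and, Set.mem_ofPred_eq] at hH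
    simp only [Finset.coe_sigma, Set.mem_sigma_iff, Finset.mem_coe, Finset.mem_powersetCard,
      Finset.subset_univ, true_and, hH, and_true]
    intro i hi
    simp_all [hvw.symm]

/-- A multigraph is the same as a function on its half-edges. -/
def halfEdgeEquiv (n m : ℕ) : (Fin m → Fin n × Fin n) ≃ (Fin m ⊕ Fin m → Fin n) :=
  (Equiv.arrowProdEquivProdArrow (Fin m) (fun _ => Fin n) (fun _ => Fin n)).trans
    (Equiv.sumArrowEquivProdArrow (Fin m) (Fin m) (Fin n)).symm

lemma deg_eq_card_fiber {n m : ℕ} (G : Fin m → Fin n × Fin n) (v : Fin n) :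
    deg G v = (Finset.univ.filter fun i => halfEdgeEquiv n m G i = v).card := by
  simp only [deg, Finset.card_filter, Fintype.sum_sum_type]
  rfl

lemma card_filter_halfEdgeEquiv {n m : ℕ} (P : (Fin m ⊕ Fin m → Fin n) → Prop)
    [DecidablePred P] :
    (Finset.univ.filter fun G => P (halfEdgeEquiv n m G)).card = (Finset.univ.filter P).card := by
  apply Finset.card_bij (fun G _ => halfEdgeEquiv n m G)
  · simp
  · simp
  · intro H hH
    exact ⟨(halfEdgeEquiv n m).symm H, by simpa using hH, by simp⟩

lemma card_deg_eq_s3 {n : ℕ} (m : ℕ) (v : Fin n) (x : ℕ) :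
    (Finset.univ.filter fun G : Fin m → Fin n × Fin n => deg G v = x).card =
      (2 * m).choose x * (n - 1) ^ (2 * m - x) := by
  simp only [deg_eq_card_fiber]
  rw [card_filter_halfEdgeEquiv
    (fun H => (Finset.univ.filter fun i => H i = v).card = x), card_filter_card_fiber_eq]
  simp [two_mul]

lemma card_deg_eq_and {n : ℕ} (m : ℕ) {v w : Fin n} (hvw : v ≠ w) (x : ℕ) :
    (Finset.univ.filter fun G : Fin m → Fin n × Fin n => deg G v = x ∧ deg G w = x).card =
      (2 * m).choose x * (2 * m - x).choose x * (n - 2) ^ (2 * m - x - x) := by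
  simp only [deg_eq_card_fiber]
  rw [card_filter_halfEdgeEquiv
    (fun H => (Finset.univ.filter fun i => H i = v).card = x ∧
      (Finset.univ.filter fun i => H i = w).card = x), card_filter_card_fiber_eq_and hvw]
  simp [two_mul]

lemma sum_card_deg_eq (n m x : ℕ) :
    ∑ G : Fin m → Fin n × Fin n, (Finset.univ.filter fun v => deg G v = x).card =
      n * ((2 * m).choose x * (n - 1) ^ (2 * m - x)) := by
  simp only [Finset.card_filter]
  rw [Finset.sum_comm]
  simp only [← Finset.card_filter, card_deg_eq_s3]
  simp

lemma sum_card_deg_eq_sq (n m x : ℕ) :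
    ∑ G : Fin m → Fin n × Fin n, (Finset.univ.filter fun v => deg G v = x).card ^ 2 =
      n * ((2 * m).choose x * (n - 1) ^ (2 * m - x)) +
      n * (n - 1) *
        ((2 * m).choose x * (2 * m - x).choose x * (n - 2) ^ (2 * m - x - x)) := by
  have h : ∀ G : Fin m → Fin n × Fin n, (Finset.univ.filter fun v => deg G v = x).card ^ 2 =
      ∑ v, ∑ w, if deg G v = x ∧ deg G w = x then 1 else 0 := by
    intro G
    rw [sq, Finset.card_filter, Finset.sum_mul_sum]
    simp only [ite_and, ite_mul, one_mul, zero_mul]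
  simp only [h]
  rw [Finset.sum_comm]
  have h' : ∀ v : Fin n, ∑ G : Fin m → Fin n × Fin n, ∑ w, (if deg G v = x ∧ deg G w = x
      then 1 else 0) = (2 * m).choose x * (n - 1) ^ (2 * m - x) + (n - 1) *
        ((2 * m).choose x * (2 * m - x).choose x * (n - 2) ^ (2 * m - x - x)) := by
    intro v
    rw [Finset.sum_comm]
    simp only [← Finset.card_filter]
    rw [← Finset.add_sum_erase _ _ (Finset.mem_univ v)]
    congr 1
    · simp [card_deg_eq_s3]
    · rw [Finset.sum_congr rfl fun w hw =>
        card_deg_eq_and m (Finset.ne_of_mem_erase hw).symm x]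
      simp
  simp only [h']
  simp
  ring

lemma eventually_le_of_tendsto_div {N : ℕ → ℕ} {l : ℝ} (hl : 0 < l)
    (hN : Tendsto (fun n => (N n : ℝ) / n) atTop (nhds l)) (j : ℕ) :
    ∀ᶠ n in atTop, j ≤ N n := by
  have h : Tendsto (fun n : ℕ => (N n : ℝ) / n * n) atTop atTop :=
    hN.pos_mul_atTop hl tendsto_natCast_atTop_atTop
  filter_upwards [h.eventually_ge_atTop (j : ℝ), eventually_gt_atTop 0] with n hn hn0
  have : (n : ℝ) ≠ 0 := by positivity
  rw [div_mul_cancel₀ _ this] at hn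
  exact_mod_cast hn

lemma tendsto_sub_div {N : ℕ → ℕ} {l : ℝ} (hl : 0 < l)
    (hN : Tendsto (fun n => (N n : ℝ) / n) atTop (nhds l)) (j : ℕ) :
    Tendsto (fun n => ((N n - j : ℕ) : ℝ) / n) atTop (nhds l) := by
  have h := hN.sub (tendsto_const_div_atTop_nhds_zero_nat (j : ℝ))
  rw [sub_zero] at h
  refine h.congr' ?_
  filter_upwards [eventually_le_of_tendsto_div hl hN j] with n hn
  rw [Nat.cast_sub hn, sub_div]

lemma tendsto_choose_div_pow {N : ℕ → ℕ} {l : ℝ} (hl : 0 < l)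
    (hN : Tendsto (fun n => (N n : ℝ) / n) atTop (nhds l)) (x : ℕ) :
    Tendsto (fun n => ((N n).choose x : ℝ) / (n : ℝ) ^ x) atTop
      (nhds (l ^ x / (Nat.factorial x))) := by
  have hdesc : Tendsto (fun n => ((N n).descFactorial x : ℝ) / (n : ℝ) ^ x) atTop
      (nhds (l ^ x)) := by
    induction x with
    | zero => simp
    | succ x ih =>
      have := (tendsto_sub_div hl hN x).mul ih
      rw [pow_succ']
      refine this.congr fun n => ?_
      rw [Nat.descFactorial_succ, pow_succ', Nat.cast_mul, mul_div_mul_comm]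
  refine (hdesc.div_const _).congr fun n => ?_
  rw [Nat.descFactorial_eq_factorial_mul_choose]
  have : (Nat.factorial x : ℝ) ≠ 0 := by positivity
  push_cast
  field_simp

lemma tendsto_one_sub_div_pow {N : ℕ → ℕ} {l : ℝ}
    (hN : Tendsto (fun n => (N n : ℝ) / n) atTop (nhds l)) (k : ℕ) :
    Tendsto (fun n : ℕ => (((n - k : ℕ) : ℝ) / n) ^ N n) atTop (nhds (Real.exp (-(k * l)))) := by
  have h := (Real.tendsto_one_add_div_pow_exp (-(k : ℝ))).rpow hN (Or.inl (Real.exp_ne_zero _))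
  rw [← Real.exp_mul, neg_mul] at h
  refine h.congr' ?_
  filter_upwards [eventually_gt_atTop k] with n hn
  have hn0 : (0 : ℝ) < n := by exact_mod_cast (Nat.zero_le k).trans_lt hn
  have hb : 1 + -(k : ℝ) / n = ((n - k : ℕ) : ℝ) / n := by
    rw [Nat.cast_sub hn.le]
    field_simp
    ring
  have hb0 : 0 ≤ ((n - k : ℕ) : ℝ) / n := by positivity
  rw [hb, ← Real.rpow_natCast, ← Real.rpow_natCast, ← Real.rpow_mul hb0, mul_div_cancel₀ _ hn0.ne']

lemma tendsto_card_deg_eq_div {N : ℕ → ℕ} {l : ℝ} (hl : 0 < l)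
    (hN : Tendsto (fun n => (N n : ℝ) / n) atTop (nhds l)) (x : ℕ) :
    Tendsto (fun n => ((N n).choose x : ℝ) * ((n - 1 : ℕ) : ℝ) ^ (N n - x) / (n : ℝ) ^ N n) atTop
      (nhds (poisson l x)) := by
  have h := (tendsto_one_sub_div_pow (tendsto_sub_div hl hN x) 1).mul
    (tendsto_choose_div_pow hl hN x)
  rw [Nat.cast_one, one_mul, ← mul_div_assoc] at h
  refine h.congr' ?_
  filter_upwards [eventually_le_of_tendsto_div hl hN x] with n hn
  rw [div_pow, div_mul_div_comm, ← pow_add, Nat.sub_add_cancel hn, mul_comm (((n - 1 : ℕ) : ℝ) ^ _)]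

lemma tendsto_card_deg_eq_and_div {N : ℕ → ℕ} {l : ℝ} (hl : 0 < l)
    (hN : Tendsto (fun n => (N n : ℝ) / n) atTop (nhds l)) (x : ℕ) :
    Tendsto (fun n => ((N n).choose x : ℝ) * ((N n - x).choose x : ℝ) *
      ((n - 2 : ℕ) : ℝ) ^ (N n - x - x) / (n : ℝ) ^ N n) atTop (nhds (poisson l x ^ 2)) := by
  have hN' := tendsto_sub_div hl hN x
  have h := (tendsto_one_sub_div_pow (tendsto_sub_div hl hN' x) 2).mul
    ((tendsto_choose_div_pow hl hN x).mul (tendsto_choose_div_pow hl hN' x))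
  have hp : Real.exp (-((2 : ℕ) * l)) * (l ^ x / (Nat.factorial x) * (l ^ x / (Nat.factorial x))) =
      poisson l x ^ 2 := by
    have : Real.exp (-((2 : ℕ) * l)) = Real.exp (-l) * Real.exp (-l) := by
      rw [← Real.exp_add]
      push_cast
      ring_nf
    rw [this, poisson]
    ring
  rw [hp] at h
  refine h.congr' ?_
  filter_upwards [eventually_le_of_tendsto_div hl hN (x + x)] with n hn
  rw [div_pow, div_mul_div_comm, div_mul_div_comm, ← pow_add, ← pow_add, Nat.sub_sub,
    Nat.sub_add_cancel hn, mul_comm (((n - 2 : ℕ) : ℝ) ^ _)]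

/-- The mean square deviation of `θ_x(G)` from `p`, in terms of the first two factorial moments. -/
lemma sum_theta_sub_sq_div {n : ℕ} (hn : 0 < n) (m x : ℕ) (p : ℝ) :
    (∑ G : Fin m → Fin n × Fin n, (theta G x - p) ^ 2) / (n : ℝ) ^ (2 * m) =
      1 / (n : ℝ) *
        (((2 * m).choose x : ℝ) * ((n - 1 : ℕ) : ℝ) ^ (2 * m - x) / (n : ℝ) ^ (2 * m)) +
      (1 - 1 / (n : ℝ)) * (((2 * m).choose x : ℝ) * ((2 * m - x).choose x : ℝ) *
        ((n - 2 : ℕ) : ℝ) ^ (2 * m - x - x) / (n : ℝ) ^ (2 * m)) -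
      2 * p *
        (((2 * m).choose x : ℝ) * ((n - 1 : ℕ) : ℝ) ^ (2 * m - x) / (n : ℝ) ^ (2 * m)) +
      p ^ 2 := by
  have hn0 : (n : ℝ) ≠ 0 := by positivity
  have h₁ := congrArg (Nat.cast (R := ℝ)) (sum_card_deg_eq n m x)
  have h₂ := congrArg (Nat.cast (R := ℝ)) (sum_card_deg_eq_sq n m x)
  simp only [Nat.cast_sum, Nat.cast_pow] at h₁ h₂
  have hexp : ∀ G : Fin m → Fin n × Fin n, (theta G x - p) ^ 2 =
      ((Finset.univ.filter fun v => deg G v = x).card : ℝ) ^ 2 * (1 / (n : ℝ) ^ 2) -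
        ((Finset.univ.filter fun v => deg G v = x).card : ℝ) * (2 * p / n) + p ^ 2 := by
    intro G
    rw [theta]
    field_simp
    ring
  have hcard : (Fintype.card (Fin m → Fin n × Fin n) : ℝ) = (n : ℝ) ^ (2 * m) := by
    simp [pow_mul, sq]
  simp only [hexp, Finset.sum_add_distrib, Finset.sum_sub_distrib, ← Finset.sum_mul, h₁, h₂,
    Finset.sum_const, Finset.card_univ, nsmul_eq_mul, hcard]
  have hsub : ((n - 1 : ℕ) : ℝ) = n - 1 := by rw [Nat.cast_sub hn, Nat.cast_one]
  push_cast
  generalize ((n - 1 : ℕ) : ℝ) ^ (2 * m - x) = a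
  rw [hsub]
  field_simp

/-- Chebyshev's inequality for the uniform distribution on a finite type. -/
lemma card_lt_abs_le_sum_sq_div {α : Type*} [Fintype α] (f : α → ℝ) {ε : ℝ} (hε : 0 < ε) :
    (Nat.card {a // ε < |f a|} : ℝ) ≤ (∑ a, f a ^ 2) / ε ^ 2 := by
  classical
  rw [le_div_iff₀ (by positivity), Nat.card_eq_fintype_card, Fintype.card_subtype,
    ← nsmul_eq_mul]
  calc _ ≤ ∑ a ∈ Finset.univ.filter fun a => ε < |f a|, f a ^ 2 := by
        refine Finset.card_nsmul_le_sum _ _ _ fun a ha => ?_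
        rw [← sq_abs (f a)]
        exact pow_le_pow_left₀ hε.le (Finset.mem_filter.1 ha).2.le 2
    _ ≤ _ := Finset.sum_le_sum_of_subset_of_nonneg (Finset.filter_subset _ _)
        fun a _ _ => sq_nonneg (f a)

/-- Let `c > 0` and `m_n / n → c`; set `λ = 2c`. For every fixed `x : ℕ` and every
`ε > 0`, the probability that a uniformly random `G : Fin (m n) → Fin n × Fin n`
satisfies `|θ_x(G) − p(x,λ)| > ε` tends to `0`. -/
theorem stmt3 (c : ℝ) (hc : 0 < c) (m : ℕ → ℕ)
    (hm : Tendsto (fun n => (m n : ℝ) / n) atTop (nhds c))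
    (x : ℕ) (ε : ℝ) (hε : 0 < ε) :
    Tendsto (fun n =>
      (Nat.card {G : Fin (m n) → Fin n × Fin n //
          ε < |theta G x - poisson (2 * c) x|} : ℝ) / (n : ℝ) ^ (2 * m n))
      atTop (nhds 0) := by
  have hN : Tendsto (fun n => ((2 * m n : ℕ) : ℝ) / n) atTop (nhds (2 * c)) := by
    refine (hm.const_mul 2).congr fun n => ?_
    push_cast
    ring
  have hl : 0 < 2 * c := by positivity
  have h₁ := tendsto_card_deg_eq_div hl hN x
  have h₂ := tendsto_card_deg_eq_and_div hl hN x
  have hinv : Tendsto (fun n : ℕ => 1 / (n : ℝ)) atTop (nhds 0) :=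
    tendsto_one_div_atTop_nhds_zero_nat
  set p := poisson (2 * c) x
  have hlim := (((((hinv.mul h₁).add ((hinv.const_sub 1).mul h₂)).sub
    (h₁.const_mul (2 * p))).add_const (p ^ 2)).div_const (ε ^ 2))
  have hzero : (0 * p + (1 - 0) * p ^ 2 - 2 * p * p + p ^ 2) / ε ^ 2 = 0 := by ring
  rw [hzero] at hlim
  refine squeeze_zero' (Eventually.of_forall fun n => by positivity) ?_ hlim
  filter_upwards [eventually_gt_atTop 0] with n hn
  rw [← sum_theta_sub_sq_div hn, div_right_comm]
  exact div_le_div_of_nonneg_right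
    (card_lt_abs_le_sum_sq_div (fun G : Fin (m n) → Fin n × Fin n => theta G x - p) hε)
    (by positivity)
end
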